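/- arXiv:1006.2565 — 2 statements merged into one kernel-verified Lean document; each statement's English description precedes it below -/
import Mathlib

section
/- Consider a discrete memoryless state-dependent broadcast channel p(y2,y3|x1,s) with i.i.d. state process (S_j,S_{1,j}) ~ p(s,s1), where the partial state sequence S1^n is known non-causally at the transmitter, receiver 2 observes Y2 and decodes private message W12, and receiver 3 observes Y3 and decodes private message W13. Let T1, T2 be auxiliary random variables on finite alphabets with joint pmf p(s,s1)·p(t1,t2|s1)·p(x1|t1,t2,s1)·p(y2,y3|x1,s). If the nonnegative rate pair (R12,R13) satisfies R13 < I(T1;Y3) − I(T1;S1), R12 < I(T2;Y2) − I(T2;S1), and R13+R12 < I(T1;Y3) + I(T2;Y2) − I(T1;S1) − I(T2;S1) − I(T1;T2|S1), then (R12,R13) is achievable (this is the region obtained from the SD-RCPM non-causal region by disabling the relay, i.e., setting S2, Q2, K2, X2, Ŷ2 trivial). -/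
/- Statement 6: Achievable rate region for the discrete memoryless state-dependent
broadcast channel with non-causal partial CSI `S₁` at the transmitter (the region of
Steinberg–Shamai, obtained from the SD-RCPM non-causal region by disabling the
relay). -/

open Finset
open scoped Classical

noncomputable section

/-- `p` is a probability mass function on a finite type. -/
def IsPmf {A : Type} [Fintype A] (p : A → ℝ) : Prop :=
  (∀ a, 0 ≤ p a) ∧ ∑ a, p a = 1

/-- `p` is a transition kernel: for each `a`, `p a` is a pmf. -/
def IsKernel {A B : Type} [Fintype B] (p : A → B → ℝ) : Prop :=
  ∀ a, IsPmf (p a)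

/-- Distribution (pmf) of a random variable `X` under the pmf `μ` on `Ω`. -/
def rvDist {Ω A : Type} [Fintype Ω] (μ : Ω → ℝ) (X : Ω → A) (a : A) : ℝ :=
  ∑ ω, if X ω = a then μ ω else 0

/-- Shannon entropy (in bits) of the random variable `X` under `μ`. -/
def rvEnt {Ω A : Type} [Fintype Ω] [Fintype A] (μ : Ω → ℝ) (X : Ω → A) : ℝ :=
  -∑ a, rvDist μ X a * Real.logb 2 (rvDist μ X a)

/-- Mutual information `I(X;Y)` under `μ`. -/
def rvMI {Ω A B : Type} [Fintype Ω] [Fintype A] [Fintype B]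
    (μ : Ω → ℝ) (X : Ω → A) (Y : Ω → B) : ℝ :=
  rvEnt μ X + rvEnt μ Y - rvEnt μ (fun ω => (X ω, Y ω))

/-- Conditional mutual information `I(X;Y|Z)` under `μ`. -/
def rvCMI {Ω A B C : Type} [Fintype Ω] [Fintype A] [Fintype B] [Fintype C]
    (μ : Ω → ℝ) (X : Ω → A) (Y : Ω → B) (Z : Ω → C) : ℝ :=
  rvEnt μ (fun ω => (X ω, Z ω)) + rvEnt μ (fun ω => (Y ω, Z ω))
    - rvEnt μ (fun ω => (X ω, Y ω, Z ω)) - rvEnt μ Z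

section BC

variable {𝒳₁ 𝒴₂ 𝒴₃ 𝒮 𝒮₁ : Type}
  [Fintype 𝒳₁] [Fintype 𝒴₂] [Fintype 𝒴₃] [Fintype 𝒮] [Fintype 𝒮₁]

/-- Average probability of error of a `((M12,M13),n)` code for the state-dependent
broadcast channel with non-causal CSI `S₁` at the transmitter: the messages are
independent and uniform, the state pairs are i.i.d. `∼ pS`, the channel is memoryless
with transition pmf `W`; receiver 2 decodes `W12` from `Y₂ⁿ` and receiver 3 decodes
`W13` from `Y₃ⁿ`. -/
def errProbBC (pS : 𝒮 × 𝒮₁ → ℝ) (W : 𝒳₁ → 𝒮 → 𝒴₂ × 𝒴₃ → ℝ)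
    {n M12 M13 : ℕ}
    (enc1 : Fin M12 → Fin M13 → (Fin n → 𝒮₁) → Fin n → 𝒳₁)
    (dec1 : (Fin n → 𝒴₂) → Fin M12)
    (dec2 : (Fin n → 𝒴₃) → Fin M13) : ℝ :=
  ∑ w12 : Fin M12, ∑ w13 : Fin M13,
    ∑ sv : Fin n → 𝒮 × 𝒮₁, ∑ yv : Fin n → 𝒴₂ × 𝒴₃,
      if dec1 (fun j => (yv j).1) = w12 ∧ dec2 (fun j => (yv j).2) = w13 then 0
      else ((M12 : ℝ) * M13)⁻¹ * (∏ j, pS (sv j)) *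
        ∏ j, W (enc1 w12 w13 (fun i => (sv i).2) j) (sv j).1 (yv j)

/-- Achievability of a nonnegative rate pair `(R12, R13)` for the state-dependent
broadcast channel with non-causal partial CSI at the transmitter. -/
def AchievableBC (pS : 𝒮 × 𝒮₁ → ℝ) (W : 𝒳₁ → 𝒮 → 𝒴₂ × 𝒴₃ → ℝ)
    (R12 R13 : ℝ) : Prop :=
  ∀ ε : ℝ, 0 < ε →
    ∃ (n M12 M13 : ℕ)
      (enc1 : Fin M12 → Fin M13 → (Fin n → 𝒮₁) → Fin n → 𝒳₁)
      (dec1 : (Fin n → 𝒴₂) → Fin M12)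
      (dec2 : (Fin n → 𝒴₃) → Fin M13),
      0 < n ∧
      (2 : ℝ) ^ ((n : ℝ) * R12) ≤ M12 ∧
      (2 : ℝ) ^ ((n : ℝ) * R13) ≤ M13 ∧
      errProbBC pS W enc1 dec1 dec2 ≤ ε

end BC

section Joint

variable {𝒮 𝒮₁ T₁ T₂ 𝒳₁ 𝒴₂ 𝒴₃ : Type}

/-- Sample space carrying `(S, S₁, T₁, T₂, X₁, Y₂, Y₃)`. -/
abbrev ΩBC (𝒮 𝒮₁ T₁ T₂ 𝒳₁ 𝒴₂ 𝒴₃ : Type) : Type :=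
  𝒮 × 𝒮₁ × T₁ × T₂ × 𝒳₁ × 𝒴₂ × 𝒴₃

def vS (ω : ΩBC 𝒮 𝒮₁ T₁ T₂ 𝒳₁ 𝒴₂ 𝒴₃) : 𝒮 := ω.1
def vS1 (ω : ΩBC 𝒮 𝒮₁ T₁ T₂ 𝒳₁ 𝒴₂ 𝒴₃) : 𝒮₁ := ω.2.1
def vT1 (ω : ΩBC 𝒮 𝒮₁ T₁ T₂ 𝒳₁ 𝒴₂ 𝒴₃) : T₁ := ω.2.2.1
def vT2 (ω : ΩBC 𝒮 𝒮₁ T₁ T₂ 𝒳₁ 𝒴₂ 𝒴₃) : T₂ := ω.2.2.2.1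
def vX1 (ω : ΩBC 𝒮 𝒮₁ T₁ T₂ 𝒳₁ 𝒴₂ 𝒴₃) : 𝒳₁ := ω.2.2.2.2.1
def vY2 (ω : ΩBC 𝒮 𝒮₁ T₁ T₂ 𝒳₁ 𝒴₂ 𝒴₃) : 𝒴₂ := ω.2.2.2.2.2.1
def vY3 (ω : ΩBC 𝒮 𝒮₁ T₁ T₂ 𝒳₁ 𝒴₂ 𝒴₃) : 𝒴₃ := ω.2.2.2.2.2.2

end Joint

/-- A function is somewhere at most its mean. -/
lemma IsPmf.exists_le_sum {A : Type} [Fintype A] {p : A → ℝ} (hp : IsPmf p) (F : A → ℝ) :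
    ∃ a, F a ≤ ∑ a, p a * F a := by
  by_contra! h
  set m := ∑ a, p a * F a with hm
  have h1 : ∑ a, p a * (F a - m) = 0 := by
    simp only [mul_sub, Finset.sum_sub_distrib, ← Finset.sum_mul, hp.2]
    rw [← hm]
    ring
  have h2 := (Finset.sum_eq_zero_iff_of_nonneg
    fun a _ => mul_nonneg (hp.1 a) (sub_nonneg.2 (h a).le)).1 h1
  have h3 : ∑ a, p a = 0 := Finset.sum_eq_zero fun a ha =>
    (mul_eq_zero.1 (h2 a ha)).resolve_right (sub_pos.2 (h a)).ne'
  rw [hp.2] at h3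
  exact one_ne_zero h3

/-! ### Expectation with respect to an i.i.d. family -/

/-- Expectation of `F` when the coordinates of `c` are i.i.d. with law `p`. -/
def iidExp {ι A : Type} [Fintype ι] [DecidableEq ι] [Fintype A] (p : A → ℝ)
    (F : (ι → A) → ℝ) : ℝ :=
  ∑ c : ι → A, (∏ i, p (c i)) * F c

section IidExp

variable {ι A : Type} [Fintype ι] [DecidableEq ι] [Fintype A] {p : A → ℝ}

lemma IsPmf.iid (hp : IsPmf p) : IsPmf (fun c : ι → A => ∏ i, p (c i)) := by
  refine ⟨fun c => Finset.prod_nonneg fun _ _ => hp.1 _, ?_⟩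
  rw [← Fintype.piFinset_univ, ← Finset.prod_univ_sum]
  simp [hp.2]

lemma iidExp_const (hp : IsPmf p) (a : ℝ) : iidExp p (fun _ : ι → A => a) = a := by
  unfold iidExp
  rw [← Finset.sum_mul, hp.iid.2, one_mul]

lemma iidExp_mono (hp : IsPmf p) {F G : (ι → A) → ℝ} (h : ∀ c, F c ≤ G c) :
    iidExp p F ≤ iidExp p G :=
  Finset.sum_le_sum fun c _ =>
    mul_le_mul_of_nonneg_left (h c) (Finset.prod_nonneg fun _ _ => hp.1 _)

lemma iidExp_nonneg (hp : IsPmf p) {F : (ι → A) → ℝ} (h : ∀ c, 0 ≤ F c) :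
    0 ≤ iidExp p F :=
  Finset.sum_nonneg fun c _ =>
    mul_nonneg (Finset.prod_nonneg fun _ _ => hp.1 _) (h c)

lemma iidExp_add (F G : (ι → A) → ℝ) :
    iidExp p (fun c => F c + G c) = iidExp p F + iidExp p G := by
  simp [iidExp, mul_add, Finset.sum_add_distrib]

lemma iidExp_mul_left (a : ℝ) (F : (ι → A) → ℝ) :
    iidExp p (fun c => a * F c) = a * iidExp p F := by
  simp only [iidExp, Finset.mul_sum]
  exact Finset.sum_congr rfl fun c _ => by ring

lemma iidExp_mul_right (a : ℝ) (F : (ι → A) → ℝ) :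
    iidExp p (fun c => F c * a) = iidExp p F * a := by
  simp only [iidExp, Finset.sum_mul]
  exact Finset.sum_congr rfl fun c _ => by ring

lemma iidExp_sum {κ : Type} (s : Finset κ) (F : κ → (ι → A) → ℝ) :
    iidExp p (fun c => ∑ k ∈ s, F k c) = ∑ k ∈ s, iidExp p (F k) := by
  simp only [iidExp, Finset.mul_sum]
  exact Finset.sum_comm

lemma iidExp_comm {κ B : Type} [Fintype κ] [DecidableEq κ] [Fintype B] {q : B → ℝ}
    (F : (ι → A) → (κ → B) → ℝ) :
    iidExp p (fun c => iidExp q (fun d => F c d)) =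
      iidExp q (fun d => iidExp p (fun c => F c d)) := by
  simp only [iidExp, Finset.mul_sum]
  rw [Finset.sum_comm]
  exact Finset.sum_congr rfl fun c _ => Finset.sum_congr rfl fun d _ => by ring

/-- Resampling one coordinate does not change the expectation. -/
lemma iidExp_resample (hp : IsPmf p) (i : ι) (F : (ι → A) → ℝ) :
    iidExp p F = iidExp p (fun c => ∑ t, p t * F (Function.update c i t)) := by
  have hinv : Function.Involutive
      (fun x : (ι → A) × A => (Function.update x.1 i x.2, x.1 i)) := by
    rintro ⟨c, t⟩
    simp
  have hw : ∀ (c : ι → A) (t : A),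
      (∏ j, p (Function.update c i t j)) * p (c i) = (∏ j, p (c j)) * p t := by
    intro c t
    have h1 : ∀ c : ι → A, ∏ j, p (c j) = p (c i) * ∏ j ∈ univ.erase i, p (c j) :=
      fun c => (Finset.mul_prod_erase univ (fun j => p (c j)) (mem_univ i)).symm
    have h2 : ∏ j ∈ univ.erase i, p (Function.update c i t j) =
        ∏ j ∈ univ.erase i, p (c j) :=
      Finset.prod_congr rfl fun j hj => by
        rw [Function.update_of_ne (Finset.ne_of_mem_erase hj)]
    rw [h1 c, h1 (Function.update c i t), h2, Function.update_self]
    ring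
  have e1 : iidExp p F = ∑ x : (ι → A) × A, (∏ j, p (x.1 j)) * p x.2 * F x.1 := by
    rw [Fintype.sum_prod_type]
    unfold iidExp
    refine Finset.sum_congr rfl fun c _ => ?_
    calc (∏ j, p (c j)) * F c = (∏ j, p (c j)) * F c * ∑ t, p t := by rw [hp.2, mul_one]
      _ = _ := by
        rw [Finset.mul_sum]
        exact Finset.sum_congr rfl fun t _ => by ring
  rw [e1, ← Equiv.sum_comp hinv.toPerm, Fintype.sum_prod_type]
  unfold iidExp
  refine Finset.sum_congr rfl fun c _ => ?_
  rw [Finset.mul_sum]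
  refine Finset.sum_congr rfl fun t _ => ?_
  simp only [Function.Involutive.coe_toPerm]
  rw [hw]
  ring

lemma iidExp_eval (hp : IsPmf p) (i : ι) (g : A → ℝ) :
    iidExp p (fun c : ι → A => g (c i)) = ∑ t, p t * g t := by
  rw [iidExp_resample hp i]
  simp only [Function.update_self]
  exact iidExp_const hp _

lemma iidExp_eval₂ (hp : IsPmf p) {i j : ι} (hij : i ≠ j) (g : A → A → ℝ) :
    iidExp p (fun c : ι → A => g (c i) (c j)) = ∑ t, p t * ∑ t', p t' * g t t' := by
  rw [iidExp_resample hp j]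
  simp only [Function.update_self, Function.update_of_ne hij]
  exact iidExp_eval hp i (fun t => ∑ t', p t' * g t t')

lemma exists_le_iidExp (hp : IsPmf p) (F : (ι → A) → ℝ) : ∃ c, F c ≤ iidExp p F :=
  hp.iid.exists_le_sum F

end IidExp

/-! ### Mutual covering -/

/-- Second moment bound behind the mutual covering lemma. -/
lemma mutual_covering_term {ι κ T₁ T₂ : Type} [Fintype ι] [DecidableEq ι] [Fintype κ]
    [DecidableEq κ] [Fintype T₁] [Fintype T₂] {p₁ : T₁ → ℝ} {p₂ : T₂ → ℝ}
    (hp₁ : IsPmf p₁) (hp₂ : IsPmf p₂) {u : T₁ → T₂ → ℝ} (hu : ∀ a b, 0 ≤ u a b)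
    {B₁₂ B₁ B₂ α : ℝ} (hB₁₂ : ∀ a b, u a b ≤ B₁₂) (hB₁ : ∀ a, ∑ b, p₂ b * u a b ≤ B₁)
    (hB₂ : ∀ b, ∑ a, p₁ a * u a b ≤ B₂) (hα : ∑ a, p₁ a * ∑ b, p₂ b * u a b = α)
    (i i' : ι) (j j' : κ) :
    iidExp p₁ (fun c => iidExp p₂ (fun d => u (c i) (d j) * u (c i') (d j'))) ≤
      α ^ 2 + (if i = i' then B₁ * α else 0) + (if j = j' then B₂ * α else 0) +
        (if i = i' then if j = j' then B₁₂ * α else 0 else 0) := by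
  have hv₁ : ∀ a, 0 ≤ ∑ b, p₂ b * u a b := fun a =>
    Finset.sum_nonneg fun b _ => mul_nonneg (hp₂.1 b) (hu a b)
  have hv₂ : ∀ b, 0 ≤ ∑ a, p₁ a * u a b := fun b =>
    Finset.sum_nonneg fun a _ => mul_nonneg (hp₁.1 a) (hu a b)
  have hα' : ∑ b, p₂ b * ∑ a, p₁ a * u a b = α := by
    rw [← hα]
    simp only [Finset.mul_sum]
    rw [Finset.sum_comm]
    exact Finset.sum_congr rfl fun a _ => Finset.sum_congr rfl fun b _ => by ring
  have hα0 : 0 ≤ α := hα ▸ Finset.sum_nonneg fun a _ => mul_nonneg (hp₁.1 a) (hv₁ a)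
  have ne₁ : Nonempty T₁ := by
    by_contra h
    rw [not_nonempty_iff] at h
    simpa using hp₁.2
  have ne₂ : Nonempty T₂ := by
    by_contra h
    rw [not_nonempty_iff] at h
    simpa using hp₂.2
  obtain ⟨a₀⟩ := ne₁
  obtain ⟨b₀⟩ := ne₂
  have hB₁0 : 0 ≤ B₁ * α := mul_nonneg ((hv₁ a₀).trans (hB₁ a₀)) hα0
  have hB₂0 : 0 ≤ B₂ * α := mul_nonneg ((hv₂ b₀).trans (hB₂ b₀)) hα0
  by_cases hj : j = j'
  · subst hj
    have e : ∀ c : ι → T₁, iidExp p₂ (fun d : κ → T₂ => u (c i) (d j) * u (c i') (d j)) =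
        ∑ b, p₂ b * (u (c i) b * u (c i') b) := fun c =>
      iidExp_eval hp₂ j (fun b => u (c i) b * u (c i') b)
    simp only [e]
    by_cases hi : i = i'
    · subst hi
      rw [iidExp_eval hp₁ i (fun a => ∑ b, p₂ b * (u a b * u a b))]
      have : ∑ a, p₁ a * ∑ b, p₂ b * (u a b * u a b) ≤ B₁₂ * α := by
        rw [← hα]
        simp only [Finset.mul_sum]
        refine Finset.sum_le_sum fun a _ => Finset.sum_le_sum fun b _ => ?_
        have := mul_le_mul_of_nonneg_right (hB₁₂ a b)
          (mul_nonneg (hp₁.1 a) (mul_nonneg (hp₂.1 b) (hu a b)))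
        linarith
      simp only [if_true]
      nlinarith [sq_nonneg α]
    · rw [iidExp_eval₂ hp₁ hi (fun a a' => ∑ b, p₂ b * (u a b * u a' b))]
      have : ∑ a, p₁ a * ∑ a', p₁ a' * ∑ b, p₂ b * (u a b * u a' b) ≤ B₂ * α := by
        calc ∑ a, p₁ a * ∑ a', p₁ a' * ∑ b, p₂ b * (u a b * u a' b)
            = ∑ b, p₂ b * ((∑ a, p₁ a * u a b) * ∑ a', p₁ a' * u a' b) := by
              simp only [Finset.mul_sum, Finset.sum_mul]
              rw [Finset.sum_comm, Finset.sum_comm_cycle]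
              refine Finset.sum_congr rfl fun b _ => ?_
              rw [Finset.sum_comm]
              exact Finset.sum_congr rfl fun a _ =>
                Finset.sum_congr rfl fun a' _ => by ring
          _ ≤ ∑ b, p₂ b * (B₂ * ∑ a', p₁ a' * u a' b) :=
              Finset.sum_le_sum fun b _ => mul_le_mul_of_nonneg_left
                (mul_le_mul_of_nonneg_right (hB₂ b) (hv₂ b)) (hp₂.1 b)
          _ = B₂ * α := by
              rw [← hα', Finset.mul_sum]
              exact Finset.sum_congr rfl fun b _ => by ring
      simp only [if_neg hi, if_true]
      nlinarith [sq_nonneg α]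
  · have e : ∀ c : ι → T₁, iidExp p₂ (fun d : κ → T₂ => u (c i) (d j) * u (c i') (d j')) =
        (∑ b, p₂ b * u (c i) b) * ∑ b, p₂ b * u (c i') b := by
      intro c
      rw [iidExp_eval₂ hp₂ hj (fun b b' => u (c i) b * u (c i') b'), Finset.sum_mul]
      refine Finset.sum_congr rfl fun b _ => ?_
      rw [mul_assoc]
      congr 1
      rw [Finset.mul_sum]
      exact Finset.sum_congr rfl fun b' _ => by ring
    simp only [e, if_neg hj]
    by_cases hi : i = i'
    · subst hi
      rw [iidExp_eval hp₁ i (fun a => (∑ b, p₂ b * u a b) * ∑ b, p₂ b * u a b)]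
      have : ∑ a, p₁ a * ((∑ b, p₂ b * u a b) * ∑ b, p₂ b * u a b) ≤ B₁ * α := by
        rw [← hα, Finset.mul_sum]
        refine Finset.sum_le_sum fun a _ => ?_
        have := mul_le_mul_of_nonneg_right (hB₁ a) (mul_nonneg (hp₁.1 a) (hv₁ a))
        linarith
      simp only [if_true]
      nlinarith [sq_nonneg α]
    · rw [iidExp_eval₂ hp₁ hi (fun a a' => (∑ b, p₂ b * u a b) * ∑ b, p₂ b * u a' b)]
      have : ∑ a, p₁ a * ∑ a', p₁ a' * ((∑ b, p₂ b * u a b) * ∑ b, p₂ b * u a' b) =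
          α ^ 2 := by
        rw [sq, ← hα, Finset.sum_mul]
        refine Finset.sum_congr rfl fun a _ => ?_
        rw [mul_assoc]
        congr 1
        rw [Finset.mul_sum]
        exact Finset.sum_congr rfl fun a' _ => by ring
      simp [if_neg hi, this]

/-- **Mutual covering lemma**, one-shot weighted form. -/
lemma mutual_covering_s6 {ι κ T₁ T₂ : Type} [Fintype ι] [DecidableEq ι] [Fintype κ]
    [DecidableEq κ] [Fintype T₁] [Fintype T₂] {p₁ : T₁ → ℝ} {p₂ : T₂ → ℝ}
    (hp₁ : IsPmf p₁) (hp₂ : IsPmf p₂) {u : T₁ → T₂ → ℝ} (hu : ∀ a b, 0 ≤ u a b)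
    {B₁₂ B₁ B₂ α : ℝ} (hB₁₂ : ∀ a b, u a b ≤ B₁₂) (hB₁ : ∀ a, ∑ b, p₂ b * u a b ≤ B₁)
    (hB₂ : ∀ b, ∑ a, p₁ a * u a b ≤ B₂) (hα : ∑ a, p₁ a * ∑ b, p₂ b * u a b = α)
    (hα1 : α ≤ 1) {L₁ L₂ : ℕ} (hL₁ : 0 < L₁) (hL₂ : 0 < L₂)
    {e₁ : Fin L₁ → ι} {e₂ : Fin L₂ → κ} (he₁ : e₁.Injective) (he₂ : e₂.Injective)
    {A : T₁ → T₂ → Prop} (huA : ∀ a b, ¬ A a b → u a b = 0) :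
    iidExp p₁ (fun c => iidExp p₂ (fun d =>
      if ∃ l : Fin L₁ × Fin L₂, A (c (e₁ l.1)) (d (e₂ l.2)) then 0 else 1)) ≤
      (1 - α) + (B₁₂ / (L₁ * L₂) + B₁ / L₁ + B₂ / L₂) := by
  set fail : (ι → T₁) → (κ → T₂) → ℝ := fun c d =>
    if ∃ l : Fin L₁ × Fin L₂, A (c (e₁ l.1)) (d (e₂ l.2)) then 0 else 1 with hfail
  set P := iidExp p₁ (fun c => iidExp p₂ (fun d => fail c d)) with hP
  set N : (ι → T₁) → (κ → T₂) → ℝ := fun c d =>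
    ∑ l₁, ∑ l₂, u (c (e₁ l₁)) (d (e₂ l₂)) with hN
  have hL₁' : (0 : ℝ) < L₁ := by exact_mod_cast hL₁
  have hL₂' : (0 : ℝ) < L₂ := by exact_mod_cast hL₂
  set m : ℝ := L₁ * L₂ * α with hm
  have hα0 : 0 ≤ α := hα ▸ Finset.sum_nonneg fun a _ => mul_nonneg (hp₁.1 a)
    (Finset.sum_nonneg fun b _ => mul_nonneg (hp₂.1 b) (hu a b))
  have hP1 : P ≤ 1 := by
    calc P ≤ iidExp p₁ (fun _ : ι → T₁ => iidExp p₂ (fun _ : κ → T₂ => (1 : ℝ))) :=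
          iidExp_mono hp₁ fun c => iidExp_mono hp₂ fun d => by
            simp only [hfail]; split_ifs <;> norm_num
      _ = 1 := by rw [iidExp_const hp₂, iidExp_const hp₁]
  have hP0 : 0 ≤ P := iidExp_nonneg hp₁ fun c => iidExp_nonneg hp₂ fun d => by
    simp only [hfail]; split_ifs <;> norm_num
  have hmean : iidExp p₁ (fun c => iidExp p₂ (fun d => N c d)) = m := by
    simp only [hN, iidExp_sum]
    have : ∀ (l₁ : Fin L₁) (l₂ : Fin L₂),
        iidExp p₁ (fun c => iidExp p₂ (fun d => u (c (e₁ l₁)) (d (e₂ l₂)))) = α := by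
      intro l₁ l₂
      rw [← hα]
      have e : ∀ c : ι → T₁, iidExp p₂ (fun d : κ → T₂ => u (c (e₁ l₁)) (d (e₂ l₂))) =
          ∑ b, p₂ b * u (c (e₁ l₁)) b := fun c =>
        iidExp_eval hp₂ (e₂ l₂) (fun b => u (c (e₁ l₁)) b)
      simp only [e]
      exact iidExp_eval hp₁ (e₁ l₁) (fun a => ∑ b, p₂ b * u a b)
    simp only [this, hm]
    simp
    ring
  have hsq : iidExp p₁ (fun c => iidExp p₂ (fun d => N c d ^ 2)) ≤
      m ^ 2 + (L₁ * L₂ * B₁₂ + L₁ * L₂ ^ 2 * B₁ + L₁ ^ 2 * L₂ * B₂) * α := by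
    have e : ∀ c d, N c d ^ 2 = ∑ l₁, ∑ l₂, ∑ k₁, ∑ k₂,
        u (c (e₁ l₁)) (d (e₂ l₂)) * u (c (e₁ k₁)) (d (e₂ k₂)) := by
      intro c d
      simp only [hN, sq, Finset.sum_mul, Finset.mul_sum]
      exact Finset.sum_congr rfl fun _ _ => Finset.sum_congr rfl fun _ _ =>
        Finset.sum_congr rfl fun _ _ => Finset.sum_congr rfl fun _ _ => mul_comm _ _
    simp only [e, iidExp_sum]
    calc _ ≤ ∑ l₁ : Fin L₁, ∑ l₂ : Fin L₂, ∑ k₁ : Fin L₁, ∑ k₂ : Fin L₂,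
          (α ^ 2 + (if l₁ = k₁ then B₁ * α else 0) + (if l₂ = k₂ then B₂ * α else 0) +
            (if l₁ = k₁ then if l₂ = k₂ then B₁₂ * α else 0 else 0)) := by
          refine Finset.sum_le_sum fun l₁ _ => Finset.sum_le_sum fun l₂ _ =>
            Finset.sum_le_sum fun k₁ _ => Finset.sum_le_sum fun k₂ _ => ?_
          have := mutual_covering_term hp₁ hp₂ hu hB₁₂ hB₁ hB₂ hα (e₁ l₁) (e₁ k₁)
            (e₂ l₂) (e₂ k₂)
          simpa only [he₁.eq_iff, he₂.eq_iff] using this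
      _ = _ := by
          simp [Finset.sum_add_distrib, hm]
          ring
  have hcheb : P * m ^ 2 ≤
      (L₁ * L₂ * B₁₂ + L₁ * L₂ ^ 2 * B₁ + L₁ ^ 2 * L₂ * B₂) * α := by
    have h1 : P * m ^ 2 ≤ iidExp p₁ (fun c => iidExp p₂ (fun d =>
        N c d ^ 2 + ((-2 * m) * N c d + m ^ 2))) := by
      rw [hP, ← iidExp_mul_right]
      simp only [← iidExp_mul_right]
      refine iidExp_mono hp₁ fun c => iidExp_mono hp₂ fun d => ?_
      simp only [hfail]
      split_ifs with h
      · nlinarith [sq_nonneg (N c d - m)]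
      · push Not at h
        have : N c d = 0 :=
          Finset.sum_eq_zero fun l₁ _ => Finset.sum_eq_zero fun l₂ _ =>
            huA _ _ (h (l₁, l₂))
        rw [this]
        linarith
    simp only [iidExp_add, iidExp_mul_left, iidExp_const hp₂, iidExp_const hp₁, hmean] at h1
    nlinarith
  rcases hα0.eq_or_lt with h0 | h0
  · have hB₁₂0 : 0 ≤ B₁₂ / (L₁ * L₂) + B₁ / L₁ + B₂ / L₂ := by
      have ne₁ : Nonempty T₁ := by
        by_contra h
        rw [not_nonempty_iff] at h
        simpa using hp₁.2
      have ne₂ : Nonempty T₂ := by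
        by_contra h
        rw [not_nonempty_iff] at h
        simpa using hp₂.2
      obtain ⟨a₀⟩ := ne₁
      obtain ⟨b₀⟩ := ne₂
      have := (hu a₀ b₀).trans (hB₁₂ a₀ b₀)
      have := (Finset.sum_nonneg fun b _ => mul_nonneg (hp₂.1 b) (hu a₀ b)).trans (hB₁ a₀)
      have := (Finset.sum_nonneg fun a _ => mul_nonneg (hp₁.1 a) (hu a b₀)).trans (hB₂ b₀)
      positivity
    linarith
  · have h2 : P * α ≤ B₁₂ / (L₁ * L₂) + B₁ / L₁ + B₂ / L₂ := by
      have e : B₁₂ / (L₁ * L₂) + B₁ / L₁ + B₂ / L₂ =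
          ((L₁ * L₂ * B₁₂ + L₁ * L₂ ^ 2 * B₁ + L₁ ^ 2 * L₂ * B₂) * α) /
            ((L₁ * L₂) ^ 2 * α) := by
        field_simp
      rw [e, le_div_iff₀ (by positivity)]
      calc P * α * ((L₁ * L₂) ^ 2 * α) = P * m ^ 2 := by rw [hm]; ring
        _ ≤ _ := hcheb
    nlinarith [mul_le_mul_of_nonneg_right hP1 (sub_nonneg.2 hα1)]

/-! ### One-shot random coding -/

/-- Decoder returning the index of a bin that contains a codeword related to `y`. -/
def binDec {M L : ℕ} {T Y : Type} (hM : 0 < M) (D : T → Y → Prop)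
    (c : Fin M × Fin L → T) (y : Y) : Fin M :=
  if h : ∃ m, ∃ l, D (c (m, l)) y then h.choose else ⟨0, hM⟩

lemma binDec_eq {M L : ℕ} {T Y : Type} (hM : 0 < M) {D : T → Y → Prop}
    {c : Fin M × Fin L → T} {y : Y} {w : Fin M} {l : Fin L} (h : D (c (w, l)) y)
    (h' : ∀ i : Fin M × Fin L, i.1 ≠ w → ¬ D (c i) y) : binDec hM D c y = w := by
  have hex : ∃ m, ∃ l, D (c (m, l)) y := ⟨w, l, h⟩
  unfold binDec
  rw [dif_pos hex]
  by_contra hne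
  obtain ⟨l', hl'⟩ := hex.choose_spec
  exact h' (hex.choose, l') hne hl'

/-- A codeword independent of the channel output is rarely related to it. -/
lemma iidExp_packing {ι T Y Y' : Type} [Fintype ι] [DecidableEq ι] [Fintype T] [Fintype Y]
    {p : T → ℝ} (hp : IsPmf p) {D : T → Y' → Prop} {π : Y → Y'} {θ g : ℝ}
    (hθ : ∀ y, ∑ t, p t * (if D t y then 1 else 0) ≤ θ) (i : ι)
    {G : (ι → T) → Y → ℝ} (hG0 : ∀ c y, 0 ≤ G c y) (hG : ∀ c, ∑ y, G c y = g)
    (hGi : ∀ c t, G (Function.update c i t) = G c) :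
    iidExp p (fun c => ∑ y, G c y * (if D (c i) (π y) then 1 else 0)) ≤ θ * g := by
  rw [iidExp_resample hp i]
  calc _ ≤ iidExp p (fun _ : ι → T => θ * g) := by
        refine iidExp_mono hp fun c => ?_
        simp only [hGi, Function.update_self, Finset.mul_sum]
        rw [Finset.sum_comm, ← hG c, Finset.mul_sum]
        refine Finset.sum_le_sum fun y _ => ?_
        calc _ = G c y * ∑ t, p t * (if D t (π y) then 1 else 0) := by
              rw [Finset.mul_sum]
              exact Finset.sum_congr rfl fun t _ => by ring
          _ ≤ G c y * θ := mul_le_mul_of_nonneg_left (hθ _) (hG0 c y)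
          _ = _ := mul_comm _ _
    _ = θ * g := iidExp_const hp _

/-- Choice of a pair of codewords from two bins, jointly related when possible. -/
def pickPair {L₁ L₂ : ℕ} {T₁ T₂ : Type} (hL₁ : 0 < L₁) (hL₂ : 0 < L₂)
    (A : T₁ → T₂ → Prop) (a : Fin L₁ → T₁) (b : Fin L₂ → T₂) : Fin L₁ × Fin L₂ :=
  if h : ∃ l : Fin L₁ × Fin L₂, A (a l.1) (b l.2) then h.choose else (⟨0, hL₁⟩, ⟨0, hL₂⟩)

lemma pickPair_spec {L₁ L₂ : ℕ} {T₁ T₂ : Type} (hL₁ : 0 < L₁) (hL₂ : 0 < L₂)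
    {A : T₁ → T₂ → Prop} {a : Fin L₁ → T₁} {b : Fin L₂ → T₂}
    (h : ∃ l : Fin L₁ × Fin L₂, A (a l.1) (b l.2)) :
    A (a (pickPair hL₁ hL₂ A a b).1) (b (pickPair hL₁ hL₂ A a b).2) := by
  unfold pickPair
  rw [dif_pos h]
  exact h.choose_spec

/-- One-shot achievability from covering and packing bounds. -/
lemma exists_code_of_covering_packing {X Y Y₂ Y₃ S T₁ T₂ : Type}
    [Fintype Y] [Fintype S] [Fintype T₁] [Fintype T₂]
    (π₂ : Y → Y₂) (π₃ : Y → Y₃) {ps : S → ℝ} (hps : IsPmf ps)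
    {p₁ : T₁ → ℝ} {p₂ : T₂ → ℝ} (hp₁ : IsPmf p₁) (hp₂ : IsPmf p₂)
    {K : S → X → Y → ℝ} (hK0 : ∀ s x y, 0 ≤ K s x y) (hK : ∀ s x, ∑ y, K s x y = ps s)
    {A : S → T₁ → T₂ → Prop} {f : S → T₁ → T₂ → X}
    {D₃ : T₁ → Y₃ → Prop} {D₂ : T₂ → Y₂ → Prop}
    {u : S → T₁ → T₂ → ℝ} (hu : ∀ s a b, 0 ≤ u s a b)
    (huA : ∀ s a b, ¬ A s a b → u s a b = 0)
    {B₁₂ B₁ B₂ η θ₃ θ₂ : ℝ} (hB₁₂ : ∀ s a b, u s a b ≤ B₁₂)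
    (hB₁ : ∀ s a, ∑ b, p₂ b * u s a b ≤ B₁) (hB₂ : ∀ s b, ∑ a, p₁ a * u s a b ≤ B₂)
    (hα : ∀ s, ∑ a, p₁ a * ∑ b, p₂ b * u s a b ≤ 1)
    (hη0 : 0 ≤ η) (hθ₃0 : 0 ≤ θ₃) (hθ₂0 : 0 ≤ θ₂)
    (hη : ∀ s a b, A s a b →
      ∑ y, K s (f s a b) y * (if D₃ a (π₃ y) ∧ D₂ b (π₂ y) then 0 else 1) ≤ η * ps s)
    (hθ₃ : ∀ y, ∑ a, p₁ a * (if D₃ a y then 1 else 0) ≤ θ₃)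
    (hθ₂ : ∀ y, ∑ b, p₂ b * (if D₂ b y then 1 else 0) ≤ θ₂)
    {M₂ L₂ M₃ L₃ : ℕ} (hM₂ : 0 < M₂) (hL₂ : 0 < L₂) (hM₃ : 0 < M₃) (hL₃ : 0 < L₃) :
    ∃ (enc : Fin M₂ → Fin M₃ → S → X) (dec₂ : Y₂ → Fin M₂) (dec₃ : Y₃ → Fin M₃),
      ∑ w₂, ∑ w₃, ∑ s, ∑ y,
        (if dec₂ (π₂ y) = w₂ ∧ dec₃ (π₃ y) = w₃ then 0
          else ((M₂ : ℝ) * M₃)⁻¹ * K s (enc w₂ w₃ s) y) ≤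
        ∑ s, ps s * (1 - ∑ a, p₁ a * ∑ b, p₂ b * u s a b) +
          (B₁₂ / (L₃ * L₂) + B₁ / L₃ + B₂ / L₂) + η + M₃ * L₃ * θ₃ + M₂ * L₂ * θ₂ := by
  let pk : (Fin M₃ × Fin L₃ → T₁) → (Fin M₂ × Fin L₂ → T₂) → Fin M₂ → Fin M₃ → S →
      Fin L₃ × Fin L₂ := fun c d w₂ w₃ s =>
    pickPair hL₃ hL₂ (A s) (fun l => c (w₃, l)) (fun l => d (w₂, l))
  let enc : (Fin M₃ × Fin L₃ → T₁) → (Fin M₂ × Fin L₂ → T₂) → Fin M₂ → Fin M₃ → S → X :=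
    fun c d w₂ w₃ s =>
      f s (c (w₃, (pk c d w₂ w₃ s).1)) (d (w₂, (pk c d w₂ w₃ s).2))
  let fail : (Fin M₃ × Fin L₃ → T₁) → (Fin M₂ × Fin L₂ → T₂) → Fin M₂ → Fin M₃ → S → ℝ :=
    fun c d w₂ w₃ s =>
      if ∃ l : Fin L₃ × Fin L₂, A s (c (w₃, l.1)) (d (w₂, l.2)) then 0 else 1
  let err : (Fin M₃ × Fin L₃ → T₁) → (Fin M₂ × Fin L₂ → T₂) → Fin M₂ → Fin M₃ → S → ℝ :=
    fun c d w₂ w₃ s => ∑ y,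
      if binDec hM₂ D₂ d (π₂ y) = w₂ ∧ binDec hM₃ D₃ c (π₃ y) = w₃ then 0
      else K s (enc c d w₂ w₃ s) y
  let wrong₃ : (Fin M₃ × Fin L₃ → T₁) → (Fin M₂ × Fin L₂ → T₂) → Fin M₂ → Fin M₃ → S → ℝ :=
    fun c d w₂ w₃ s => ∑ i ∈ univ.filter (fun i : Fin M₃ × Fin L₃ => i.1 ≠ w₃),
      ∑ y, K s (enc c d w₂ w₃ s) y * (if D₃ (c i) (π₃ y) then 1 else 0)
  let wrong₂ : (Fin M₃ × Fin L₃ → T₁) → (Fin M₂ × Fin L₂ → T₂) → Fin M₂ → Fin M₃ → S → ℝ :=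
    fun c d w₂ w₃ s => ∑ i ∈ univ.filter (fun i : Fin M₂ × Fin L₂ => i.1 ≠ w₂),
      ∑ y, K s (enc c d w₂ w₃ s) y * (if D₂ (d i) (π₂ y) then 1 else 0)
  have herr : ∀ c d w₂ w₃ s, err c d w₂ w₃ s ≤
      ps s * fail c d w₂ w₃ s + (η * ps s + (wrong₃ c d w₂ w₃ s + wrong₂ c d w₂ w₃ s)) := by
    intro c d w₂ w₃ s
    have hw₃ : 0 ≤ wrong₃ c d w₂ w₃ s := Finset.sum_nonneg fun i _ =>
      Finset.sum_nonneg fun y _ => mul_nonneg (hK0 _ _ _) (by split_ifs <;> norm_num)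
    have hw₂ : 0 ≤ wrong₂ c d w₂ w₃ s := Finset.sum_nonneg fun i _ =>
      Finset.sum_nonneg fun y _ => mul_nonneg (hK0 _ _ _) (by split_ifs <;> norm_num)
    have hηp : 0 ≤ η * ps s := mul_nonneg hη0 (hps.1 s)
    by_cases hA : ∃ l : Fin L₃ × Fin L₂, A s (c (w₃, l.1)) (d (w₂, l.2))
    · have hA' := pickPair_spec hL₃ hL₂ (A := A s) (a := fun l => c (w₃, l))
        (b := fun l => d (w₂, l)) hA
      have h1 := hη s _ _ hA'
      have h2 : err c d w₂ w₃ s ≤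
          ∑ y, K s (enc c d w₂ w₃ s) y *
            (if D₃ (c (w₃, (pk c d w₂ w₃ s).1)) (π₃ y) ∧
              D₂ (d (w₂, (pk c d w₂ w₃ s).2)) (π₂ y) then 0 else 1) +
          (wrong₃ c d w₂ w₃ s + wrong₂ c d w₂ w₃ s) := by
        simp only [err, wrong₃, wrong₂]
        rw [Finset.sum_comm (s := univ.filter (fun i : Fin M₃ × Fin L₃ => i.1 ≠ w₃)),
          Finset.sum_comm (s := univ.filter (fun i : Fin M₂ × Fin L₂ => i.1 ≠ w₂)),
          ← Finset.sum_add_distrib, ← Finset.sum_add_distrib]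
        refine Finset.sum_le_sum fun y _ => ?_
        have hK' := hK0 s (enc c d w₂ w₃ s) y
        have n₃ : ∀ i ∈ univ.filter (fun i : Fin M₃ × Fin L₃ => i.1 ≠ w₃),
            0 ≤ K s (enc c d w₂ w₃ s) y * (if D₃ (c i) (π₃ y) then (1 : ℝ) else 0) :=
          fun i _ => mul_nonneg hK' (by split_ifs <;> norm_num)
        have n₂ : ∀ i ∈ univ.filter (fun i : Fin M₂ × Fin L₂ => i.1 ≠ w₂),
            0 ≤ K s (enc c d w₂ w₃ s) y * (if D₂ (d i) (π₂ y) then (1 : ℝ) else 0) :=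
          fun i _ => mul_nonneg hK' (by split_ifs <;> norm_num)
        have s₃ := Finset.sum_nonneg n₃
        have s₂ := Finset.sum_nonneg n₂
        by_cases hD : D₃ (c (w₃, (pk c d w₂ w₃ s).1)) (π₃ y) ∧
            D₂ (d (w₂, (pk c d w₂ w₃ s).2)) (π₂ y)
        · rw [if_pos hD, mul_zero, zero_add]
          by_cases h₃ : ∀ i : Fin M₃ × Fin L₃, i.1 ≠ w₃ → ¬ D₃ (c i) (π₃ y)
          · by_cases h₂ : ∀ i : Fin M₂ × Fin L₂, i.1 ≠ w₂ → ¬ D₂ (d i) (π₂ y)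
            · rw [if_pos ⟨binDec_eq hM₂ hD.2 h₂, binDec_eq hM₃ hD.1 h₃⟩]
              linarith
            · push Not at h₂
              obtain ⟨i, hi, hDi⟩ := h₂
              have := Finset.single_le_sum n₂ (by simpa using hi : i ∈ _)
              rw [if_pos hDi] at this
              split_ifs <;> linarith
          · push Not at h₃
            obtain ⟨i, hi, hDi⟩ := h₃
            have := Finset.single_le_sum n₃ (by simpa using hi : i ∈ _)
            rw [if_pos hDi] at this
            split_ifs <;> linarith
        · rw [if_neg hD, mul_one]
          split_ifs <;> linarith
      simp only [fail, if_pos hA, mul_zero, zero_add]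
      exact h2.trans (add_le_add_left h1 _)
    · simp only [fail, if_neg hA, mul_one]
      have : err c d w₂ w₃ s ≤ ps s := by
        rw [← hK s (enc c d w₂ w₃ s)]
        refine Finset.sum_le_sum fun y _ => ?_
        have := hK0 s (enc c d w₂ w₃ s) y
        split_ifs <;> linarith
      linarith
  have hfail : ∀ w₂ w₃ s, iidExp p₁ (fun c => iidExp p₂ (fun d => fail c d w₂ w₃ s)) ≤
      (1 - ∑ a, p₁ a * ∑ b, p₂ b * u s a b) +
        (B₁₂ / (L₃ * L₂) + B₁ / L₃ + B₂ / L₂) := fun w₂ w₃ s =>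
    mutual_covering_s6 hp₁ hp₂ (hu s) (hB₁₂ s) (hB₁ s) (hB₂ s) rfl (hα s) hL₃ hL₂
      (e₁ := fun l => (w₃, l)) (e₂ := fun l => (w₂, l))
      (fun l l' h => (Prod.ext_iff.1 h).2) (fun l l' h => (Prod.ext_iff.1 h).2) (huA s)
  have hwrong₃ : ∀ w₂ w₃ s, iidExp p₁ (fun c => iidExp p₂ (fun d => wrong₃ c d w₂ w₃ s)) ≤
      M₃ * L₃ * θ₃ * ps s := by
    intro w₂ w₃ s
    rw [iidExp_comm]
    calc _ ≤ iidExp p₂ (fun _ : Fin M₂ × Fin L₂ → T₂ => M₃ * L₃ * θ₃ * ps s) := by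
          refine iidExp_mono hp₂ fun d => ?_
          simp only [wrong₃]
          rw [iidExp_sum]
          calc _ ≤ ∑ i ∈ univ.filter (fun i : Fin M₃ × Fin L₃ => i.1 ≠ w₃), θ₃ * ps s := by
                refine Finset.sum_le_sum fun i hi => ?_
                have hi' : i.1 ≠ w₃ := by simpa using hi
                refine iidExp_packing hp₁ hθ₃ i (fun c y => hK0 _ _ _)
                  (fun c => hK _ _) fun c t => ?_
                have hne : ∀ l, (w₃, l) ≠ i := fun l h => hi' (by rw [← h])
                simp only [enc, pk, Function.update_of_ne (hne _)]
            _ ≤ ∑ i : Fin M₃ × Fin L₃, θ₃ * ps s :=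
                Finset.sum_le_sum_of_subset_of_nonneg (Finset.filter_subset _ _)
                  fun _ _ _ => mul_nonneg hθ₃0 (hps.1 s)
            _ = _ := by simp; ring
      _ = _ := iidExp_const hp₂ _
  have hwrong₂ : ∀ w₂ w₃ s, iidExp p₁ (fun c => iidExp p₂ (fun d => wrong₂ c d w₂ w₃ s)) ≤
      M₂ * L₂ * θ₂ * ps s := by
    intro w₂ w₃ s
    calc _ ≤ iidExp p₁ (fun _ : Fin M₃ × Fin L₃ → T₁ => M₂ * L₂ * θ₂ * ps s) := by
          refine iidExp_mono hp₁ fun c => ?_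
          simp only [wrong₂]
          rw [iidExp_sum]
          calc _ ≤ ∑ i ∈ univ.filter (fun i : Fin M₂ × Fin L₂ => i.1 ≠ w₂), θ₂ * ps s := by
                refine Finset.sum_le_sum fun i hi => ?_
                have hi' : i.1 ≠ w₂ := by simpa using hi
                refine iidExp_packing hp₂ hθ₂ i (fun c y => hK0 _ _ _)
                  (fun c => hK _ _) fun c t => ?_
                have hne : ∀ l, (w₂, l) ≠ i := fun l h => hi' (by rw [← h])
                simp only [enc, pk, Function.update_of_ne (hne _)]
            _ ≤ ∑ i : Fin M₂ × Fin L₂, θ₂ * ps s :=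
                Finset.sum_le_sum_of_subset_of_nonneg (Finset.filter_subset _ _)
                  fun _ _ _ => mul_nonneg hθ₂0 (hps.1 s)
            _ = _ := by simp; ring
      _ = _ := iidExp_const hp₁ _
  have hM : (0 : ℝ) < (M₂ : ℝ) * M₃ := by positivity
  set C : ℝ := ∑ s, ps s * (1 - ∑ a, p₁ a * ∑ b, p₂ b * u s a b) +
          (B₁₂ / (L₃ * L₂) + B₁ / L₃ + B₂ / L₂) + η + M₃ * L₃ * θ₃ + M₂ * L₂ * θ₂ with hC
  have hmsg : ∀ w₂ w₃, iidExp p₁ (fun c => iidExp p₂ (fun d => ∑ s, err c d w₂ w₃ s)) ≤ C := by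
    intro w₂ w₃
    simp only [iidExp_sum]
    calc _ ≤ ∑ s, (ps s * ((1 - ∑ a, p₁ a * ∑ b, p₂ b * u s a b) +
        (B₁₂ / (L₃ * L₂) + B₁ / L₃ + B₂ / L₂)) +
          (η * ps s + (M₃ * L₃ * θ₃ * ps s + M₂ * L₂ * θ₂ * ps s))) := by
          refine Finset.sum_le_sum fun s _ => ?_
          calc _ ≤ _ := iidExp_mono hp₁ fun c => iidExp_mono hp₂ fun d => herr c d w₂ w₃ s
            _ ≤ _ := by
              simp only [iidExp_add, iidExp_mul_left, iidExp_const hp₁, iidExp_const hp₂]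
              exact add_le_add (mul_le_mul_of_nonneg_left (hfail _ _ _) (hps.1 s))
                (add_le_add_right (add_le_add (hwrong₃ _ _ _) (hwrong₂ _ _ _)) _)
      _ = C := by
          simp only [mul_add, Finset.sum_add_distrib, ← Finset.sum_mul, ← Finset.mul_sum,
            hps.2, hC]
          ring
  obtain ⟨c, hc⟩ := exists_le_iidExp hp₁ (fun c : Fin M₃ × Fin L₃ → T₁ =>
    iidExp p₂ (fun d : Fin M₂ × Fin L₂ → T₂ => ∑ w₂, ∑ w₃, ∑ s, err c d w₂ w₃ s))
  obtain ⟨d, hd⟩ := exists_le_iidExp hp₂ (fun d : Fin M₂ × Fin L₂ → T₂ =>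
    ∑ w₂, ∑ w₃, ∑ s, err c d w₂ w₃ s)
  refine ⟨enc c d, binDec hM₂ D₂ d, binDec hM₃ D₃ c, ?_⟩
  have hsum : ∑ w₂, ∑ w₃, ∑ s, err c d w₂ w₃ s ≤ M₂ * M₃ * C := by
    refine (hd.trans hc).trans ?_
    simp only [iidExp_sum (p := p₂) (univ : Finset (Fin M₂)),
      iidExp_sum (p := p₁) (univ : Finset (Fin M₂)),
      iidExp_sum (p := p₂) (univ : Finset (Fin M₃)),
      iidExp_sum (p := p₁) (univ : Finset (Fin M₃))]
    calc _ ≤ ∑ _w₂ : Fin M₂, ∑ _w₃ : Fin M₃, C :=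
          Finset.sum_le_sum fun w₂ _ => Finset.sum_le_sum fun w₃ _ => hmsg w₂ w₃
      _ = _ := by simp; ring
  calc _ = ((M₂ : ℝ) * M₃)⁻¹ * ∑ w₂, ∑ w₃, ∑ s, err c d w₂ w₃ s := by
        simp only [err, Finset.mul_sum, mul_ite, mul_zero]
    _ ≤ ((M₂ : ℝ) * M₃)⁻¹ * (M₂ * M₃ * C) :=
        mul_le_mul_of_nonneg_left hsum (inv_nonneg.2 hM.le)
    _ = C := by field_simp

lemma sum_fiberwise_mul {Θ S : Type} [Fintype Θ] [Fintype S] (g : Θ → S) (pΘ : Θ → ℝ)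
    (F : S → Θ → ℝ) :
    ∑ s, ∑ σ, (if g σ = s then pΘ σ else 0) * F s σ = ∑ σ, pΘ σ * F (g σ) σ := by
  rw [Finset.sum_comm]
  simp [ite_mul]

/-- One-shot information-spectrum achievability for the broadcast channel with state `σ`
observed at the transmitter through `g`. The set `E` collects the triples of typical
information density. -/
lemma exists_code_of_information_spectrum {Θ S T₁ T₂ X Y Y₂ Y₃ : Type}
    [Fintype Θ] [Fintype S] [Fintype T₁] [Fintype T₂] [Fintype X] [Fintype Y]
    (g : Θ → S) (π₂ : Y → Y₂) (π₃ : Y → Y₃)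
    {pΘ : Θ → ℝ} (hpΘ : IsPmf pΘ) {pT : S → T₁ → T₂ → ℝ} (hpT0 : ∀ s a b, 0 ≤ pT s a b)
    (hpT : ∀ s, ∑ a, ∑ b, pT s a b = 1)
    {pX : S → T₁ → T₂ → X → ℝ} (hpX : ∀ s a b, IsPmf (pX s a b))
    {W : X → Θ → Y → ℝ} (hW : ∀ x σ, IsPmf (W x σ))
    {p₁ : T₁ → ℝ} {p₂ : T₂ → ℝ} (hp₁ : IsPmf p₁) (hp₂ : IsPmf p₂)
    (hac : ∀ σ a b, pΘ σ ≠ 0 → pT (g σ) a b ≠ 0 → p₁ a ≠ 0 ∧ p₂ b ≠ 0)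
    {E : S → T₁ → T₂ → Prop} {D₃ : T₁ → Y₃ → Prop} {D₂ : T₂ → Y₂ → Prop}
    {B₁₂ B₁ B₂ η θ₃ θ₂ : ℝ} (hB₁₂0 : 0 ≤ B₁₂) (hB₁0 : 0 ≤ B₁) (hB₂0 : 0 ≤ B₂)
    (hB₁₂ : ∀ s a b, E s a b → pT s a b / (p₁ a * p₂ b) ≤ B₁₂)
    (hB₁ : ∀ s a b, E s a b → (∑ b, pT s a b) / p₁ a ≤ B₁)
    (hB₂ : ∀ s a b, E s a b → (∑ a, pT s a b) / p₂ b ≤ B₂)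
    (hη0 : 0 < η) (hθ₃0 : 0 ≤ θ₃) (hθ₂0 : 0 ≤ θ₂)
    (hθ₃ : ∀ y, ∑ a, p₁ a * (if D₃ a y then 1 else 0) ≤ θ₃)
    (hθ₂ : ∀ y, ∑ b, p₂ b * (if D₂ b y then 1 else 0) ≤ θ₂)
    {M₂ L₂ M₃ L₃ : ℕ} (hM₂ : 0 < M₂) (hL₂ : 0 < L₂) (hM₃ : 0 < M₃) (hL₃ : 0 < L₃) :
    ∃ (enc : Fin M₂ → Fin M₃ → S → X) (dec₂ : Y₂ → Fin M₂) (dec₃ : Y₃ → Fin M₃),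
      ∑ w₂, ∑ w₃, ∑ σ, ∑ y,
        (if dec₂ (π₂ y) = w₂ ∧ dec₃ (π₃ y) = w₃ then 0
          else ((M₂ : ℝ) * M₃)⁻¹ * pΘ σ * W (enc w₂ w₃ (g σ)) σ y) ≤
        ∑ σ, ∑ a, ∑ b, pΘ σ * pT (g σ) a b * (if E (g σ) a b then 0 else 1) +
        (∑ σ, ∑ a, ∑ b, ∑ x, ∑ y, pΘ σ * pT (g σ) a b * pX (g σ) a b x * W x σ y *
          (if D₃ a (π₃ y) ∧ D₂ b (π₂ y) then 0 else 1)) / η +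
          (B₁₂ / (L₃ * L₂) + B₁ / L₃ + B₂ / L₂) + η + M₃ * L₃ * θ₃ + M₂ * L₂ * θ₂ := by
  set ps : S → ℝ := fun s => ∑ σ, if g σ = s then pΘ σ else 0 with hps_def
  have hps : IsPmf ps := by
    refine ⟨fun s => Finset.sum_nonneg fun σ _ => ?_, ?_⟩
    · split_ifs
      exacts [hpΘ.1 σ, le_rfl]
    · simpa [hpΘ.2] using sum_fiberwise_mul g pΘ (fun _ _ => 1)
  set K : S → X → Y → ℝ := fun s x y => ∑ σ, (if g σ = s then pΘ σ else 0) * W x σ y with hKd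
  have hK0 : ∀ s x y, 0 ≤ K s x y := fun s x y => Finset.sum_nonneg fun σ _ =>
    mul_nonneg (by split_ifs; exacts [hpΘ.1 σ, le_rfl]) ((hW x σ).1 y)
  have hK : ∀ s x, ∑ y, K s x y = ps s := by
    intro s x
    simp only [hKd]
    rw [Finset.sum_comm]
    simp only [← Finset.mul_sum, (hW x _).2, mul_one, hps_def]
  set bad : T₁ → T₂ → Y → ℝ := fun a b y =>
    if D₃ a (π₃ y) ∧ D₂ b (π₂ y) then 0 else 1 with hbad
  have hbad0 : ∀ a b y, 0 ≤ bad a b y := fun a b y => by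
    simp only [hbad]; split_ifs <;> norm_num
  set β : S → T₁ → T₂ → ℝ := fun s a b =>
    ∑ x, pX s a b x * ∑ y, K s x y * bad a b y with hβ
  have hβ0 : ∀ s a b, 0 ≤ β s a b := fun s a b => Finset.sum_nonneg fun x _ =>
    mul_nonneg ((hpX s a b).1 x) (Finset.sum_nonneg fun y _ =>
      mul_nonneg (hK0 s x y) (hbad0 a b y))
  choose f hf using fun s a b =>
    (hpX s a b).exists_le_sum (fun x => ∑ y, K s x y * bad a b y)
  set A : S → T₁ → T₂ → Prop := fun s a b => E s a b ∧ β s a b ≤ η * ps s with hA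
  set u : S → T₁ → T₂ → ℝ := fun s a b =>
    if A s a b then pT s a b / (p₁ a * p₂ b) else 0 with hu
  have hu0 : ∀ s a b, 0 ≤ u s a b := fun s a b => by
    simp only [hu]
    split_ifs
    exacts [div_nonneg (hpT0 s a b) (mul_nonneg (hp₁.1 a) (hp₂.1 b)), le_rfl]
  have hu1 : ∀ s a b, p₂ b * u s a b ≤ pT s a b / p₁ a := by
    intro s a b
    have h0 := div_nonneg (hpT0 s a b) (hp₁.1 a)
    simp only [hu]
    split_ifs
    · rcases eq_or_ne (p₂ b) 0 with h | h
      · simpa [h] using h0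
      · exact le_of_eq (by rw [mul_comm (p₁ a), ← mul_div_assoc, mul_div_mul_left _ _ h])
    · simpa using h0
  have hu2 : ∀ s a b, p₁ a * u s a b ≤ pT s a b / p₂ b := by
    intro s a b
    have h0 := div_nonneg (hpT0 s a b) (hp₂.1 b)
    simp only [hu]
    split_ifs
    · rcases eq_or_ne (p₁ a) 0 with h | h
      · simpa [h] using h0
      · exact le_of_eq (by rw [← mul_div_assoc, mul_div_mul_left _ _ h])
    · simpa using h0
  have hα : ∀ s, ∑ a, p₁ a * ∑ b, p₂ b * u s a b ≤ 1 := by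
    intro s
    rw [← hpT s]
    refine Finset.sum_le_sum fun a _ => ?_
    calc p₁ a * ∑ b, p₂ b * u s a b ≤ p₁ a * ∑ b, pT s a b / p₁ a :=
          mul_le_mul_of_nonneg_left (Finset.sum_le_sum fun b _ => hu1 s a b) (hp₁.1 a)
      _ ≤ ∑ b, pT s a b := by
          rw [← Finset.sum_div]
          rcases eq_or_ne (p₁ a) 0 with h | h
          · rw [h, zero_mul]
            exact Finset.sum_nonneg fun b _ => hpT0 s a b
          · rw [mul_div_cancel₀ _ h]
  obtain ⟨enc, dec₂, dec₃, hcode⟩ := exists_code_of_covering_packing π₂ π₃ hps hp₁ hp₂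
    hK0 hK (A := A) (f := f) (D₃ := D₃) (D₂ := D₂) hu0
    (fun s a b h => by simp only [hu, if_neg h])
    (B₁₂ := B₁₂) (B₁ := B₁) (B₂ := B₂) (η := η)
    (fun s a b => by
      simp only [hu]
      split_ifs with h
      exacts [hB₁₂ s a b h.1, hB₁₂0])
    (fun s a => by
      by_cases h : ∃ b, A s a b
      · obtain ⟨b, hb⟩ := h
        refine le_trans (Finset.sum_le_sum fun b _ => hu1 s a b) ?_
        rw [← Finset.sum_div]
        exact hB₁ s a b hb.1
      · push Not at h
        simp only [hu, if_neg (h _), mul_zero, Finset.sum_const_zero]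
        exact hB₁0)
    (fun s b => by
      by_cases h : ∃ a, A s a b
      · obtain ⟨a, ha⟩ := h
        refine le_trans (Finset.sum_le_sum fun a _ => hu2 s a b) ?_
        rw [← Finset.sum_div]
        exact hB₂ s a b ha.1
      · push Not at h
        simp only [hu, if_neg (h _), mul_zero, Finset.sum_const_zero]
        exact hB₂0)
    hα hη0.le hθ₃0 hθ₂0 (fun s a b h => (hf s a b).trans h.2) hθ₃ hθ₂ hM₂ hL₂ hM₃ hL₃
  refine ⟨enc, dec₂, dec₃, ?_⟩
  have herr : ∀ w₂ w₃, ∑ σ, ∑ y,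
        (if dec₂ (π₂ y) = w₂ ∧ dec₃ (π₃ y) = w₃ then 0
          else ((M₂ : ℝ) * M₃)⁻¹ * pΘ σ * W (enc w₂ w₃ (g σ)) σ y) =
      ∑ s, ∑ y, (if dec₂ (π₂ y) = w₂ ∧ dec₃ (π₃ y) = w₃ then 0
          else ((M₂ : ℝ) * M₃)⁻¹ * K s (enc w₂ w₃ s) y) := by
    intro w₂ w₃
    have := sum_fiberwise_mul g pΘ (fun s σ => ∑ y,
      (if dec₂ (π₂ y) = w₂ ∧ dec₃ (π₃ y) = w₃ then 0
          else ((M₂ : ℝ) * M₃)⁻¹ * W (enc w₂ w₃ s) σ y))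
    calc _ = _ := by
          refine Finset.sum_congr rfl fun σ _ => ?_
          rw [Finset.mul_sum]
          refine Finset.sum_congr rfl fun y _ => ?_
          split_ifs <;> ring
      _ = _ := this.symm
      _ = _ := by
          refine Finset.sum_congr rfl fun s _ => ?_
          simp only [Finset.mul_sum]
          rw [Finset.sum_comm]
          refine Finset.sum_congr rfl fun y _ => ?_
          split_ifs
          · simp
          · rw [hKd, Finset.mul_sum]
            exact Finset.sum_congr rfl fun σ _ => by ring
  simp only [herr]
  refine hcode.trans ?_
  have hps_ac : ∀ s a b, ps s * (p₁ a * (p₂ b * u s a b)) =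
      ps s * (pT s a b * if A s a b then 1 else 0) := by
    intro s a b
    simp only [hu]
    split_ifs
    · by_cases h : p₁ a ≠ 0 ∧ p₂ b ≠ 0
      · obtain ⟨h₁, h₂⟩ := h
        field_simp
      · suffices h0 : ps s * pT s a b = 0 by
          rw [mul_one, h0, ← mul_assoc (p₁ a)]
          rcases not_and_or.1 h with h' | h' <;> · rw [not_not] at h'; simp [h']
        simp only [hps_def, Finset.sum_mul]
        refine Finset.sum_eq_zero fun σ _ => ?_
        split_ifs with hg
        · by_contra hne
          exact h (hac σ a b (left_ne_zero_of_mul hne)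
            (by rw [hg]; exact right_ne_zero_of_mul hne))
        · exact zero_mul _
    · simp
  have hmain : ∑ s, ps s * (1 - ∑ a, p₁ a * ∑ b, p₂ b * u s a b) ≤
      ∑ σ, ∑ a, ∑ b, pΘ σ * pT (g σ) a b * (if E (g σ) a b then 0 else 1) +
        (∑ σ, ∑ a, ∑ b, ∑ x, ∑ y, pΘ σ * pT (g σ) a b * pX (g σ) a b x * W x σ y *
          bad a b y) / η := by
    have e1 : ∑ σ, ∑ a, ∑ b, pΘ σ * pT (g σ) a b * (if E (g σ) a b then (0 : ℝ) else 1) =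
        ∑ s, ∑ a, ∑ b, ps s * (pT s a b * (if E s a b then 0 else 1)) := by
      have := sum_fiberwise_mul g pΘ
        (fun s _ => ∑ a, ∑ b, pT s a b * (if E s a b then (0 : ℝ) else 1))
      simp only [← Finset.sum_mul] at this
      simp only [← Finset.mul_sum, mul_assoc]
      exact this.symm
    have e2 : ∑ σ, ∑ a, ∑ b, ∑ x, ∑ y, pΘ σ * pT (g σ) a b * pX (g σ) a b x * W x σ y *
          bad a b y = ∑ s, ∑ a, ∑ b, pT s a b * β s a b := by
      have := sum_fiberwise_mul g pΘ
        (fun s σ => ∑ a, ∑ b, pT s a b * ∑ x, pX s a b x * ∑ y, W x σ y * bad a b y)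
      simp only [mul_assoc, ← Finset.mul_sum]
      rw [← this]
      refine Finset.sum_congr rfl fun s _ => ?_
      simp only [Finset.mul_sum]
      rw [Finset.sum_comm]
      refine Finset.sum_congr rfl fun a _ => ?_
      rw [Finset.sum_comm]
      refine Finset.sum_congr rfl fun b _ => ?_
      simp only [hβ, hKd, Finset.mul_sum, Finset.sum_mul]
      rw [Finset.sum_comm]
      refine Finset.sum_congr rfl fun x _ => ?_
      rw [Finset.sum_comm]
      exact Finset.sum_congr rfl fun y _ => Finset.sum_congr rfl fun σ _ => by ring
    rw [e1, e2, Finset.sum_div, ← Finset.sum_add_distrib]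
    refine Finset.sum_le_sum fun s _ => ?_
    have hone : ps s = ∑ a, ∑ b, ps s * pT s a b := by
      simp only [← Finset.mul_sum]
      rw [hpT, mul_one]
    rw [mul_sub, mul_one]
    nth_rewrite 1 [hone]
    simp only [Finset.mul_sum, hps_ac]
    rw [← Finset.sum_sub_distrib, Finset.sum_div, ← Finset.sum_add_distrib]
    refine Finset.sum_le_sum fun a _ => ?_
    rw [← Finset.sum_sub_distrib, Finset.sum_div, ← Finset.sum_add_distrib]
    refine Finset.sum_le_sum fun b _ => ?_
    have hT := hpT0 s a b
    have hTβ := div_nonneg (mul_nonneg hT (hβ0 s a b)) hη0.le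
    by_cases hE : E s a b
    · by_cases hb : β s a b ≤ η * ps s
      · simp only [hA, hE, hb, and_self, if_true, mul_one, mul_zero, zero_add, sub_self]
        exact hTβ
      · simp only [hA, hE, hb, and_false, if_true, if_false, mul_zero, zero_add, sub_zero]
        rw [le_div_iff₀ hη0]
        push Not at hb
        nlinarith
    · simp only [hA, hE, false_and, if_false, mul_one, mul_zero, sub_zero]
      linarith
  linarith

/-! ### Distributions, information densities and the law of large numbers -/

section Information

variable {Ω A B C : Type} [Fintype Ω] {μ : Ω → ℝ}

lemma sum_rvDist_mul [Fintype A] (X : Ω → A) (F : A → ℝ) :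
    ∑ a, rvDist μ X a * F a = ∑ ω, μ ω * F (X ω) := by
  simp only [rvDist, Finset.sum_mul]
  rw [Finset.sum_comm]
  simp [ite_mul]

lemma rvDist_nonneg (hμ : IsPmf μ) (X : Ω → A) (a : A) : 0 ≤ rvDist μ X a :=
  Finset.sum_nonneg fun ω _ => by
    split_ifs
    exacts [hμ.1 ω, le_rfl]

lemma isPmf_rvDist [Fintype A] (hμ : IsPmf μ) (X : Ω → A) : IsPmf (rvDist μ X) :=
  ⟨rvDist_nonneg hμ X, by simpa [hμ.2] using sum_rvDist_mul (μ := μ) X (fun _ => 1)⟩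

lemma rvDist_pos (hμ : IsPmf μ) (X : Ω → A) {ω : Ω} (h : μ ω ≠ 0) :
    0 < rvDist μ X (X ω) := by
  refine lt_of_lt_of_le ((hμ.1 ω).lt_of_ne' h) ?_
  have := Finset.single_le_sum (f := fun ω' => if X ω' = X ω then μ ω' else 0)
    (fun ω' _ => by split_ifs; exacts [hμ.1 ω', le_rfl]) (mem_univ ω)
  simpa [rvDist] using this

lemma sum_rvDist_prod_left [Fintype A] (X : Ω → A) (Y : Ω → B) (b : B) :
    ∑ a, rvDist μ (fun ω => (X ω, Y ω)) (a, b) = rvDist μ Y b := by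
  simp only [rvDist]
  rw [Finset.sum_comm]
  refine Finset.sum_congr rfl fun ω _ => ?_
  by_cases h : Y ω = b <;> simp [h]

lemma rvEnt_eq_sum [Fintype A] (X : Ω → A) :
    rvEnt μ X = -∑ ω, μ ω * Real.logb 2 (rvDist μ X (X ω)) := by
  rw [rvEnt, sum_rvDist_mul X (fun a => Real.logb 2 (rvDist μ X a))]

lemma rvMI_eq_sum [Fintype A] [Fintype B] (hμ : IsPmf μ) (X : Ω → A) (Y : Ω → B) :
    rvMI μ X Y = ∑ ω, μ ω * Real.logb 2 (rvDist μ (fun ω => (X ω, Y ω)) (X ω, Y ω) /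
      (rvDist μ X (X ω) * rvDist μ Y (Y ω))) := by
  simp only [rvMI, rvEnt_eq_sum, ← Finset.sum_neg_distrib, ← Finset.sum_add_distrib,
    ← Finset.sum_sub_distrib]
  refine Finset.sum_congr rfl fun ω _ => ?_
  rcases eq_or_ne (μ ω) 0 with h | h
  · simp [h]
  · have h1 := (rvDist_pos hμ X h).ne'
    have h2 := (rvDist_pos hμ Y h).ne'
    have h3 := (rvDist_pos hμ (fun ω => (X ω, Y ω)) h).ne'
    rw [Real.logb_div h3 (mul_ne_zero h1 h2), Real.logb_mul h1 h2]
    ring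

lemma rvMI_nonneg [Fintype A] [Fintype B] (hμ : IsPmf μ) (X : Ω → A) (Y : Ω → B) :
    0 ≤ rvMI μ X Y := by
  rw [rvMI_eq_sum hμ]
  have hlog : (0 : ℝ) < Real.log 2 := Real.log_pos (by norm_num)
  set q : Ω → ℝ := fun ω => rvDist μ X (X ω) * rvDist μ Y (Y ω) /
    rvDist μ (fun ω => (X ω, Y ω)) (X ω, Y ω) with hq
  have h1 : ∑ ω, μ ω * q ω ≤ 1 := by
    have e := sum_rvDist_mul (μ := μ) (fun ω => (X ω, Y ω)) (fun z =>
      rvDist μ X z.1 * rvDist μ Y z.2 / rvDist μ (fun ω => (X ω, Y ω)) z)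
    calc ∑ ω, μ ω * q ω = _ := e.symm
      _ ≤ ∑ z : A × B, rvDist μ X z.1 * rvDist μ Y z.2 := by
          refine Finset.sum_le_sum fun z _ => ?_
          rcases eq_or_ne (rvDist μ (fun ω => (X ω, Y ω)) z) 0 with h | h
          · rw [h, zero_mul]
            exact mul_nonneg (rvDist_nonneg hμ X _) (rvDist_nonneg hμ Y _)
          · rw [mul_div_cancel₀ _ h]
      _ = 1 := by
          rw [Fintype.sum_prod_type]
          simp only [← Finset.mul_sum, (isPmf_rvDist hμ Y).2, mul_one]
          exact (isPmf_rvDist hμ X).2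
  have h2 : ∑ ω, μ ω * ((1 - q ω) / Real.log 2) ≤
      ∑ ω, μ ω * Real.logb 2 (rvDist μ (fun ω => (X ω, Y ω)) (X ω, Y ω) /
        (rvDist μ X (X ω) * rvDist μ Y (Y ω))) := by
    refine Finset.sum_le_sum fun ω _ => ?_
    rcases eq_or_ne (μ ω) 0 with h | h
    · simp [h]
    · refine mul_le_mul_of_nonneg_left ?_ (hμ.1 ω)
      have hx := rvDist_pos hμ X h
      have hy := rvDist_pos hμ Y h
      have hxy := rvDist_pos hμ (fun ω => (X ω, Y ω)) h
      rw [Real.logb, ← inv_div (rvDist μ X (X ω) * rvDist μ Y (Y ω)), Real.log_inv]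
      refine div_le_div_of_nonneg_right ?_ hlog.le
      have := Real.log_le_sub_one_of_pos (div_pos (mul_pos hx hy) hxy)
      simp only [hq]
      linarith
  refine le_trans ?_ h2
  have h3 : ∑ ω, μ ω * ((1 - q ω) / Real.log 2) =
      (∑ ω, μ ω - ∑ ω, μ ω * q ω) / Real.log 2 := by
    rw [← Finset.sum_sub_distrib, Finset.sum_div]
    exact Finset.sum_congr rfl fun ω _ => by ring
  rw [h3, hμ.2]
  exact div_nonneg (by linarith) hlog.le

/-- Chebyshev's inequality for an i.i.d. sample. -/
lemma iidExp_deviation_le (hμ : IsPmf μ) (G : Ω → ℝ) {δ : ℝ} (hδ : 0 < δ) {n : ℕ}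
    (hn : 0 < n) :
    iidExp μ (fun ω : Fin n → Ω =>
      if |∑ j, G (ω j) - n * ∑ x, μ x * G x| ≤ n * δ then (0 : ℝ) else 1) ≤
      (∑ x, μ x * (G x - ∑ x, μ x * G x) ^ 2) / δ ^ 2 / n := by
  set m := ∑ x, μ x * G x with hm
  have hn' : (0 : ℝ) < n := by exact_mod_cast hn
  have hmean : ∑ x, μ x * (G x - m) = 0 := by
    simp only [mul_sub, Finset.sum_sub_distrib, ← Finset.sum_mul, hμ.2]
    rw [← hm]
    ring
  have hvar : iidExp μ (fun ω : Fin n → Ω => (∑ j, (G (ω j) - m)) ^ 2) =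
      n * ∑ x, μ x * (G x - m) ^ 2 := by
    simp only [sq, Finset.sum_mul_sum, iidExp_sum]
    have : ∀ j k : Fin n, iidExp μ (fun ω : Fin n → Ω => (G (ω j) - m) * (G (ω k) - m)) =
        if j = k then ∑ x, μ x * ((G x - m) * (G x - m)) else 0 := by
      intro j k
      split_ifs with h
      · subst h
        exact iidExp_eval hμ j (fun x => (G x - m) * (G x - m))
      · rw [iidExp_eval₂ hμ h (fun x y => (G x - m) * (G y - m))]
        refine Finset.sum_eq_zero fun x _ => ?_
        have : ∑ y, μ y * ((G x - m) * (G y - m)) = (G x - m) * ∑ y, μ y * (G y - m) := by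
          rw [Finset.mul_sum]
          exact Finset.sum_congr rfl fun y _ => by ring
        rw [this, hmean]
        ring
    simp [this]
  calc _ ≤ iidExp μ (fun ω : Fin n → Ω => (n * δ) ^ (-2 : ℤ) *
        (∑ j, (G (ω j) - m)) ^ 2) := by
        refine iidExp_mono hμ fun ω => ?_
        have e : ∑ j, (G (ω j) - m) = ∑ j, G (ω j) - n * m := by
          simp [Finset.sum_sub_distrib]
        rw [e]
        split_ifs with h
        · positivity
        · push Not at h
          have h2 : (n * δ) ^ 2 ≤ (∑ j, G (ω j) - n * m) ^ 2 := by
            rw [← sq_abs (∑ j, G (ω j) - n * m)]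
            exact pow_le_pow_left₀ (by positivity) h.le 2
          rw [zpow_neg, ← div_eq_inv_mul, le_div_iff₀ (by positivity), one_mul]
          exact_mod_cast h2
    _ = _ := by
        rw [iidExp_mul_left, hvar, zpow_neg]
        norm_cast
        field_simp

/-- Asymptotic equipartition for a density `r` positive on the support of `μ`. -/
lemma iidExp_aep (hμ : IsPmf μ) {r : Ω → ℝ} (hr : ∀ ω, μ ω ≠ 0 → 0 < r ω) {m : ℝ}
    (hm : m = ∑ ω, μ ω * Real.logb 2 (r ω)) {δ : ℝ} (hδ : 0 < δ) :
    ∃ V : ℝ, ∀ n : ℕ, 0 < n → iidExp μ (fun ω : Fin n → Ω =>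
      if (2 : ℝ) ^ ((n : ℝ) * (m - δ)) ≤ ∏ j, r (ω j) ∧
        ∏ j, r (ω j) ≤ (2 : ℝ) ^ ((n : ℝ) * (m + δ)) then (0 : ℝ) else 1) ≤ V / n := by
  refine ⟨_, fun n hn => le_trans ?_
    (iidExp_deviation_le hμ (fun ω => Real.logb 2 (r ω)) hδ hn)⟩
  rw [← hm]
  refine Finset.sum_le_sum fun ω _ => ?_
  rcases eq_or_ne (∏ j, μ (ω j)) 0 with h | h
  · rw [h, zero_mul, zero_mul]
  · refine mul_le_mul_of_nonneg_left ?_ (Finset.prod_nonneg fun _ _ => hμ.1 _)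
    have hpos : ∀ j, 0 < r (ω j) := fun j =>
      hr _ (Finset.prod_ne_zero_iff.1 h j (mem_univ j))
    have hprod : ∏ j, r (ω j) = (2 : ℝ) ^ (∑ j, Real.logb 2 (r (ω j))) := by
      rw [Real.rpow_sum_of_pos (by norm_num)]
      exact Finset.prod_congr rfl fun j _ =>
        (Real.rpow_logb (by norm_num) (by norm_num) (hpos j)).symm
    beta_reduce
    by_cases hd : |∑ j, Real.logb 2 (r (ω j)) - n * m| ≤ n * δ
    · have hd' := abs_le.1 hd
      rw [if_pos hd, if_pos]
      rw [hprod]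
      constructor <;> refine Real.rpow_le_rpow_of_exponent_le (by norm_num) ?_ <;> linarith
    · rw [if_neg hd]
      split_ifs <;> norm_num

end Information

/-- Packing bound for the likelihood-ratio test `G * (p a * q b) ≤ r (a, b)`. -/
lemma sum_likelihood_test_le {A B : Type} [Fintype A] {p : A → ℝ} {q : B → ℝ}
    {r : A → B → ℝ} (hr : ∀ a b, 0 ≤ r a b) (hrq : ∀ b, ∑ a, r a b = q b) {G : ℝ}
    (hG : 0 < G) (b : B) :
    ∑ a, p a * (if G * (p a * q b) ≤ r a b ∧ 0 < q b then 1 else 0) ≤ G⁻¹ := by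
  rcases lt_or_ge 0 (q b) with hq | hq
  · calc _ ≤ ∑ a, r a b / (G * q b) := by
          refine Finset.sum_le_sum fun a _ => ?_
          split_ifs with h
          · rw [mul_one, le_div_iff₀ (mul_pos hG hq)]
            linarith [h.1]
          · rw [mul_zero]
            exact div_nonneg (hr a b) (mul_pos hG hq).le
      _ = G⁻¹ := by
          rw [← Finset.sum_div, hrq]
          field_simp
  · simp only [not_lt.2 hq, and_false, if_false, mul_zero, Finset.sum_const_zero]
    exact (inv_pos.2 hG).le

lemma sum_pi_prod {n : ℕ} {A : Type} [Fintype A] (F : Fin n → A → ℝ) :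
    ∑ a : Fin n → A, ∏ j, F j (a j) = ∏ j, ∑ a, F j a := by
  rw [Finset.prod_univ_sum, Fintype.piFinset_univ]

/-! ### Random coding over `n` channel uses -/

lemma iidExp_mono_support {ι A : Type} [Fintype ι] [DecidableEq ι] [Fintype A] {p : A → ℝ}
    (hp : IsPmf p) {F G : (ι → A) → ℝ} (h : ∀ c, (∀ i, p (c i) ≠ 0) → F c ≤ G c) :
    iidExp p F ≤ iidExp p G := by
  refine Finset.sum_le_sum fun c _ => ?_
  by_cases hc : ∀ i, p (c i) ≠ 0
  · exact mul_le_mul_of_nonneg_left (h c hc) (Finset.prod_nonneg fun _ _ => hp.1 _)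
  · push Not at hc
    obtain ⟨i, hi⟩ := hc
    rw [Finset.prod_eq_zero (mem_univ i) hi, zero_mul, zero_mul]

section Joint

variable {𝒳₁ 𝒴₂ 𝒴₃ 𝒮 𝒮₁ T₁ T₂ : Type}
  [Fintype 𝒳₁] [Fintype 𝒴₂] [Fintype 𝒴₃] [Fintype 𝒮] [Fintype 𝒮₁] [Fintype T₁] [Fintype T₂]

/-- The factorization of the joint pmf of `(S, S₁, T₁, T₂, X₁, Y₂, Y₃)`. -/
structure JointFactors (pS : 𝒮 × 𝒮₁ → ℝ) (W : 𝒳₁ → 𝒮 → 𝒴₂ × 𝒴₃ → ℝ)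
    (pT : 𝒮₁ → T₁ × T₂ → ℝ) (pX1 : T₁ × T₂ × 𝒮₁ → 𝒳₁ → ℝ)
    (μ : ΩBC 𝒮 𝒮₁ T₁ T₂ 𝒳₁ 𝒴₂ 𝒴₃ → ℝ) : Prop where
  state : IsPmf pS
  channel : ∀ x1 s, IsPmf (W x1 s)
  aux : IsKernel pT
  input : IsKernel pX1
  joint : ∀ s s1 t1 t2 x1 y2 y3, μ (s, s1, t1, t2, x1, y2, y3) =
    pS (s, s1) * pT s1 (t1, t2) * pX1 (t1, t2, s1) x1 * W x1 s (y2, y3)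

namespace JointFactors

variable {pS : 𝒮 × 𝒮₁ → ℝ} {W : 𝒳₁ → 𝒮 → 𝒴₂ × 𝒴₃ → ℝ} {pT : 𝒮₁ → T₁ × T₂ → ℝ}
  {pX1 : T₁ × T₂ × 𝒮₁ → 𝒳₁ → ℝ} {μ : ΩBC 𝒮 𝒮₁ T₁ T₂ 𝒳₁ 𝒴₂ 𝒴₃ → ℝ}

lemma apply_eq (h : JointFactors pS W pT pX1 μ) (ω : ΩBC 𝒮 𝒮₁ T₁ T₂ 𝒳₁ 𝒴₂ 𝒴₃) :
    μ ω = pS (vS ω, vS1 ω) * pT (vS1 ω) (vT1 ω, vT2 ω) *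
      pX1 (vT1 ω, vT2 ω, vS1 ω) (vX1 ω) * W (vX1 ω) (vS ω) (vY2 ω, vY3 ω) :=
  h.joint _ _ _ _ _ _ _

/-- Expectation of a function of `(S₁, T₁, T₂)`. -/
lemma sum_mul_aux (h : JointFactors pS W pT pX1 μ) (F : 𝒮₁ → T₁ → T₂ → ℝ) :
    ∑ ω, μ ω * F (vS1 ω) (vT1 ω) (vT2 ω) =
      ∑ s1, ∑ s, pS (s, s1) * ∑ t1, ∑ t2, pT s1 (t1, t2) * F s1 t1 t2 := by
  have hW : ∀ x s, ∑ y2, ∑ y3, W x s (y2, y3) = 1 := fun x s => by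
    rw [← Fintype.sum_prod_type]
    exact (h.channel x s).2
  rw [Finset.sum_comm]
  simp only [Fintype.sum_prod_type, h.joint, vS1, vT1, vT2]
  refine Finset.sum_congr rfl fun s _ => Finset.sum_congr rfl fun s1 _ => ?_
  rw [Finset.mul_sum]
  refine Finset.sum_congr rfl fun t1 _ => ?_
  rw [Finset.mul_sum]
  refine Finset.sum_congr rfl fun t2 _ => ?_
  simp only [← Finset.sum_mul, ← Finset.mul_sum, hW, mul_one, (h.input _).2]
  ring

lemma isPmf (h : JointFactors pS W pT pX1 μ) : IsPmf μ := by
  refine ⟨fun ω => ?_, ?_⟩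
  · rw [h.apply_eq]
    exact mul_nonneg (mul_nonneg (mul_nonneg (h.state.1 _) ((h.aux _).1 _))
      ((h.input _).1 _)) ((h.channel _ _).1 _)
  · have := h.sum_mul_aux (fun _ _ _ => 1)
    simp only [mul_one] at this
    rw [this]
    simp only [← Fintype.sum_prod_type (f := pT _), (h.aux _).2, mul_one]
    rw [Finset.sum_comm, ← Fintype.sum_prod_type (f := pS)]
    exact h.state.2

lemma exists_ne_zero (h : JointFactors pS W pT pX1 μ) {s : 𝒮} {s1 : 𝒮₁} {t1 : T₁} {t2 : T₂}
    (hs : pS (s, s1) ≠ 0) (ht : pT s1 (t1, t2) ≠ 0) :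
    ∃ ω, μ ω ≠ 0 ∧ vT1 ω = t1 ∧ vT2 ω = t2 := by
  have key : ∀ {A : Type} [Fintype A] {p : A → ℝ}, IsPmf p → ∃ a, p a ≠ 0 := by
    intro A _ p hp
    by_contra! h0
    simpa [h0] using hp.2
  obtain ⟨x, hx⟩ := key (h.input (t1, t2, s1))
  obtain ⟨⟨y2, y3⟩, hy⟩ := key (h.channel x s)
  refine ⟨(s, s1, t1, t2, x, y2, y3), ?_, rfl, rfl⟩
  rw [h.joint]
  exact mul_ne_zero (mul_ne_zero (mul_ne_zero hs ht) hx) hy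

lemma rvDist_S1 (h : JointFactors pS W pT pX1 μ) (s1 : 𝒮₁) :
    rvDist μ vS1 s1 = ∑ s, pS (s, s1) := by
  have := h.sum_mul_aux (fun s _ _ => if s = s1 then 1 else 0)
  simp only [mul_ite, mul_one, mul_zero] at this
  rw [rvDist, this, Finset.sum_eq_single s1]
  · simp only [if_true, ← Fintype.sum_prod_type (f := pT _), (h.aux _).2, mul_one]
  · intro s _ hs
    simp [hs]
  · simp

lemma rvDist_T1T2S1 (h : JointFactors pS W pT pX1 μ) (t1 : T₁) (t2 : T₂) (s1 : 𝒮₁) :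
    rvDist μ (fun ω => (vT1 ω, vT2 ω, vS1 ω)) (t1, t2, s1) =
      rvDist μ vS1 s1 * pT s1 (t1, t2) := by
  have := h.sum_mul_aux (fun s a b => if s = s1 then if a = t1 then if b = t2 then 1 else 0
    else 0 else 0)
  simp only [mul_ite, mul_one, mul_zero] at this
  rw [h.rvDist_S1, Finset.sum_mul]
  simp only [rvDist, Prod.mk.injEq]
  calc _ = _ := Finset.sum_congr rfl fun ω _ => by
        split_ifs <;> first | rfl | (exfalso; tauto)
    _ = _ := this
    _ = _ := by
      rw [Finset.sum_eq_single s1]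
      · simp
      · intro s _ hs
        simp [hs]
      · simp

lemma rvDist_T1S1 (h : JointFactors pS W pT pX1 μ) (t1 : T₁) (s1 : 𝒮₁) :
    rvDist μ (fun ω => (vT1 ω, vS1 ω)) (t1, s1) =
      rvDist μ vS1 s1 * ∑ t2, pT s1 (t1, t2) := by
  rw [Finset.mul_sum]
  simp only [← h.rvDist_T1T2S1]
  simp only [rvDist]
  rw [Finset.sum_comm]
  refine Finset.sum_congr rfl fun ω _ => ?_
  by_cases h1 : vT1 ω = t1 <;> by_cases h2 : vS1 ω = s1 <;> simp [h1, h2]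

lemma rvDist_T2S1 (h : JointFactors pS W pT pX1 μ) (t2 : T₂) (s1 : 𝒮₁) :
    rvDist μ (fun ω => (vT2 ω, vS1 ω)) (t2, s1) =
      rvDist μ vS1 s1 * ∑ t1, pT s1 (t1, t2) := by
  rw [Finset.mul_sum]
  simp only [← h.rvDist_T1T2S1]
  simp only [rvDist]
  rw [Finset.sum_comm]
  refine Finset.sum_congr rfl fun ω _ => ?_
  by_cases h1 : vT2 ω = t2 <;> by_cases h2 : vS1 ω = s1 <;> simp [h1, h2]

lemma rvMI_T1_S1 (h : JointFactors pS W pT pX1 μ) :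
    rvMI μ vT1 vS1 = ∑ ω, μ ω * Real.logb 2
      ((∑ t2, pT (vS1 ω) (vT1 ω, t2)) / rvDist μ vT1 (vT1 ω)) := by
  rw [rvMI_eq_sum h.isPmf]
  refine Finset.sum_congr rfl fun ω _ => ?_
  rcases eq_or_ne (μ ω) 0 with h0 | h0
  · simp [h0]
  · have := (rvDist_pos h.isPmf vS1 h0).ne'
    rw [h.rvDist_T1S1, mul_comm (rvDist μ vT1 _), mul_div_mul_left _ _ this]

lemma rvMI_T2_S1 (h : JointFactors pS W pT pX1 μ) :
    rvMI μ vT2 vS1 = ∑ ω, μ ω * Real.logb 2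
      ((∑ t1, pT (vS1 ω) (t1, vT2 ω)) / rvDist μ vT2 (vT2 ω)) := by
  rw [rvMI_eq_sum h.isPmf]
  refine Finset.sum_congr rfl fun ω _ => ?_
  rcases eq_or_ne (μ ω) 0 with h0 | h0
  · simp [h0]
  · have := (rvDist_pos h.isPmf vS1 h0).ne'
    rw [h.rvDist_T2S1, mul_comm (rvDist μ vT2 _), mul_div_mul_left _ _ this]

lemma aux_ne_zero (h : JointFactors pS W pT pX1 μ) {ω : ΩBC 𝒮 𝒮₁ T₁ T₂ 𝒳₁ 𝒴₂ 𝒴₃}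
    (h0 : μ ω ≠ 0) : pT (vS1 ω) (vT1 ω, vT2 ω) ≠ 0 := by
  rw [h.apply_eq] at h0
  exact right_ne_zero_of_mul (left_ne_zero_of_mul (left_ne_zero_of_mul h0))

lemma rvMI_add_rvCMI (h : JointFactors pS W pT pX1 μ) :
    rvMI μ vT1 vS1 + rvMI μ vT2 vS1 + rvCMI μ vT1 vT2 vS1 = ∑ ω, μ ω * Real.logb 2
      (pT (vS1 ω) (vT1 ω, vT2 ω) / (rvDist μ vT1 (vT1 ω) * rvDist μ vT2 (vT2 ω))) := by
  have e : rvMI μ vT1 vS1 + rvMI μ vT2 vS1 + rvCMI μ vT1 vT2 vS1 =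
      rvEnt μ vT1 + rvEnt μ vT2 + rvEnt μ vS1 -
        rvEnt μ (fun ω => (vT1 ω, vT2 ω, vS1 ω)) := by
    simp only [rvMI, rvCMI]
    ring
  rw [e]
  simp only [rvEnt_eq_sum, ← Finset.sum_neg_distrib, ← Finset.sum_add_distrib,
    ← Finset.sum_sub_distrib]
  refine Finset.sum_congr rfl fun ω _ => ?_
  rcases eq_or_ne (μ ω) 0 with h0 | h0
  · simp [h0]
  · have h1 := (rvDist_pos h.isPmf vT1 h0).ne'
    have h2 := (rvDist_pos h.isPmf vT2 h0).ne'
    have h3 := (rvDist_pos h.isPmf vS1 h0).ne'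
    have h4 := h.aux_ne_zero h0
    rw [h.rvDist_T1T2S1, Real.logb_mul h3 h4, Real.logb_div h4 (mul_ne_zero h1 h2),
      Real.logb_mul h1 h2]
    ring

/-- Expectation under `n` i.i.d. copies of the joint pmf, as an iterated sum. -/
lemma iidExp_eq (h : JointFactors pS W pT pX1 μ) {n : ℕ}
    (F : (Fin n → 𝒮 × 𝒮₁) → (Fin n → T₁) → (Fin n → T₂) → (Fin n → 𝒳₁) →
      (Fin n → 𝒴₂ × 𝒴₃) → ℝ) :
    iidExp μ (fun ω : Fin n → _ => F (fun j => (vS (ω j), vS1 (ω j))) (fun j => vT1 (ω j))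
      (fun j => vT2 (ω j)) (fun j => vX1 (ω j)) (fun j => (vY2 (ω j), vY3 (ω j)))) =
    ∑ σ : Fin n → 𝒮 × 𝒮₁, ∑ a : Fin n → T₁, ∑ b : Fin n → T₂, ∑ x : Fin n → 𝒳₁,
      ∑ y : Fin n → 𝒴₂ × 𝒴₃, (∏ j, pS (σ j)) * (∏ j, pT (σ j).2 (a j, b j)) *
        (∏ j, pX1 (a j, b j, (σ j).2) (x j)) * (∏ j, W (x j) (σ j).1 (y j)) *
          F σ a b x y := by
  let e : (Fin n → ΩBC 𝒮 𝒮₁ T₁ T₂ 𝒳₁ 𝒴₂ 𝒴₃) ≃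
      (Fin n → 𝒮 × 𝒮₁) × (Fin n → T₁) × (Fin n → T₂) × (Fin n → 𝒳₁) ×
        (Fin n → 𝒴₂ × 𝒴₃) :=
    { toFun := fun ω => (fun j => (vS (ω j), vS1 (ω j)), fun j => vT1 (ω j),
        fun j => vT2 (ω j), fun j => vX1 (ω j), fun j => (vY2 (ω j), vY3 (ω j)))
      invFun := fun z j => ((z.1 j).1, (z.1 j).2, z.2.1 j, z.2.2.1 j, z.2.2.2.1 j,
        (z.2.2.2.2 j).1, (z.2.2.2.2 j).2)
      left_inv := fun _ => rfl
      right_inv := fun _ => rfl }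
  have := Equiv.sum_comp e (fun z => (∏ j, pS (z.1 j)) *
    (∏ j, pT (z.1 j).2 (z.2.1 j, z.2.2.1 j)) *
    (∏ j, pX1 (z.2.1 j, z.2.2.1 j, (z.1 j).2) (z.2.2.2.1 j)) *
    (∏ j, W (z.2.2.2.1 j) (z.1 j).1 (z.2.2.2.2 j)) *
    F z.1 z.2.1 z.2.2.1 z.2.2.2.1 z.2.2.2.2)
  simp only [Fintype.sum_prod_type] at this
  rw [← this]
  refine Finset.sum_congr rfl fun ω _ => ?_
  simp only [h.apply_eq, Finset.prod_mul_distrib]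
  rfl

end JointFactors

end Joint

/-- Packing bound for `n` uses of the likelihood-ratio test between `X` and `Y`. -/
lemma sum_likelihood_test_iid_le {Ω A B : Type} [Fintype Ω] [Fintype A] {μ : Ω → ℝ}
    (hμ : IsPmf μ) (X : Ω → A) (Y : Ω → B) {n : ℕ} {D : (Fin n → A) → (Fin n → B) → Prop}
    {G : ℝ} (hG : 0 < G)
    (hD : ∀ a y, D a y ↔ G * ((∏ j, rvDist μ X (a j)) * ∏ j, rvDist μ Y (y j)) ≤
      ∏ j, rvDist μ (fun ω => (X ω, Y ω)) (a j, y j) ∧ 0 < ∏ j, rvDist μ Y (y j))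
    (y : Fin n → B) :
    ∑ a : Fin n → A, (∏ j, rvDist μ X (a j)) * (if D a y then 1 else 0) ≤ G⁻¹ := by
  refine le_trans (le_of_eq ?_) (sum_likelihood_test_le
    (p := fun a : Fin n → A => ∏ j, rvDist μ X (a j))
    (q := fun y : Fin n → B => ∏ j, rvDist μ Y (y j))
    (r := fun a y => ∏ j, rvDist μ (fun ω => (X ω, Y ω)) (a j, y j))
    (fun a b => Finset.prod_nonneg fun _ _ => rvDist_nonneg hμ _ _) (fun b => ?_) hG y)
  · exact Finset.sum_congr rfl fun a _ => by simp only [hD]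
  · rw [sum_pi_prod (fun j a => rvDist μ (fun ω => (X ω, Y ω)) (a, b j))]
    simp only [sum_rvDist_prod_left]

lemma isPmf_prod {n : ℕ} {A : Type} [Fintype A] {p : Fin n → A → ℝ} (hp : ∀ j, IsPmf (p j)) :
    IsPmf (fun a : Fin n → A => ∏ j, p j (a j)) := by
  refine ⟨fun a => Finset.prod_nonneg fun j _ => (hp j).1 _, ?_⟩
  rw [sum_pi_prod p]
  exact Finset.prod_eq_one fun j _ => (hp j).2

section RandomCoding

variable {𝒳₁ 𝒴₂ 𝒴₃ 𝒮 𝒮₁ T₁ T₂ : Type}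
  [Fintype 𝒳₁] [Fintype 𝒴₂] [Fintype 𝒴₃] [Fintype 𝒮] [Fintype 𝒮₁] [Fintype T₁] [Fintype T₂]

namespace JointFactors

variable {pS : 𝒮 × 𝒮₁ → ℝ} {W : 𝒳₁ → 𝒮 → 𝒴₂ × 𝒴₃ → ℝ} {pT : 𝒮₁ → T₁ × T₂ → ℝ}
  {pX1 : T₁ × T₂ × 𝒮₁ → 𝒳₁ → ℝ} {μ : ΩBC 𝒮 𝒮₁ T₁ T₂ 𝒳₁ 𝒴₂ 𝒴₃ → ℝ}

/-- The `n`-fold expectation of a function of the states and the auxiliary variables. -/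
lemma iidExp_eq_aux (h : JointFactors pS W pT pX1 μ) {n : ℕ}
    (F : (Fin n → 𝒮 × 𝒮₁) → (Fin n → T₁) → (Fin n → T₂) → ℝ) :
    iidExp μ (fun ω : Fin n → _ => F (fun j => (vS (ω j), vS1 (ω j))) (fun j => vT1 (ω j))
      (fun j => vT2 (ω j))) =
    ∑ σ : Fin n → 𝒮 × 𝒮₁, ∑ a : Fin n → T₁, ∑ b : Fin n → T₂,
      (∏ j, pS (σ j)) * (∏ j, pT (σ j).2 (a j, b j)) * F σ a b := by
  rw [h.iidExp_eq (fun σ a b _ _ => F σ a b)]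
  refine Finset.sum_congr rfl fun σ _ => Finset.sum_congr rfl fun a _ =>
    Finset.sum_congr rfl fun b _ => ?_
  have hX := isPmf_prod (fun j => h.input (a j, b j, (σ j).2))
  have hY := fun x : Fin n → 𝒳₁ => isPmf_prod (fun j => h.channel (x j) (σ j).1)
  simp only [← Finset.sum_mul, ← Finset.mul_sum, (hY _).2, hX.2, mul_one]

/-- Typicality of the states and the auxiliary variables. -/
lemma exists_encoding_bound (h : JointFactors pS W pT pX1 μ) {δ : ℝ} (hδ : 0 < δ) :
    ∃ V : ℝ, ∀ n : ℕ, 0 < n → ∃ E : (Fin n → 𝒮₁) → (Fin n → T₁) → (Fin n → T₂) → Prop,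
      (∀ s a b, E s a b ↔
        (∏ j, pT (s j) (a j, b j)) / ((∏ j, rvDist μ vT1 (a j)) * ∏ j, rvDist μ vT2 (b j)) ≤
            2 ^ ((n : ℝ) * (rvMI μ vT1 vS1 + rvMI μ vT2 vS1 + rvCMI μ vT1 vT2 vS1 + δ)) ∧
        (∑ b : Fin n → T₂, ∏ j, pT (s j) (a j, b j)) / (∏ j, rvDist μ vT1 (a j)) ≤
            2 ^ ((n : ℝ) * (rvMI μ vT1 vS1 + δ)) ∧
        (∑ a : Fin n → T₁, ∏ j, pT (s j) (a j, b j)) / (∏ j, rvDist μ vT2 (b j)) ≤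
            2 ^ ((n : ℝ) * (rvMI μ vT2 vS1 + δ))) ∧
      ∑ σ : Fin n → 𝒮 × 𝒮₁, ∑ a : Fin n → T₁, ∑ b : Fin n → T₂,
        (∏ j, pS (σ j)) * (∏ j, pT (σ j).2 (a j, b j)) *
          (if E (fun j => (σ j).2) a b then 0 else 1) ≤ V / n := by
  have hμ := h.isPmf
  have hpT : ∀ s z, 0 ≤ pT s z := fun s z => (h.aux s).1 z
  obtain ⟨V₁₂, h₁₂⟩ := iidExp_aep hμ (r := fun ω => pT (vS1 ω) (vT1 ω, vT2 ω) /
      (rvDist μ vT1 (vT1 ω) * rvDist μ vT2 (vT2 ω)))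
    (fun ω hω => div_pos ((hpT _ _).lt_of_ne' (h.aux_ne_zero hω))
      (mul_pos (rvDist_pos hμ vT1 hω) (rvDist_pos hμ vT2 hω))) h.rvMI_add_rvCMI hδ
  obtain ⟨V₁, h₁⟩ := iidExp_aep hμ
    (r := fun ω => (∑ t2, pT (vS1 ω) (vT1 ω, t2)) / rvDist μ vT1 (vT1 ω))
    (fun ω hω => div_pos (Finset.sum_pos' (fun _ _ => hpT _ _)
      ⟨vT2 ω, mem_univ _, (hpT _ _).lt_of_ne' (h.aux_ne_zero hω)⟩) (rvDist_pos hμ vT1 hω))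
    h.rvMI_T1_S1 hδ
  obtain ⟨V₂, h₂⟩ := iidExp_aep hμ
    (r := fun ω => (∑ t1, pT (vS1 ω) (t1, vT2 ω)) / rvDist μ vT2 (vT2 ω))
    (fun ω hω => div_pos (Finset.sum_pos' (fun _ _ => hpT _ _)
      ⟨vT1 ω, mem_univ _, (hpT _ _).lt_of_ne' (h.aux_ne_zero hω)⟩) (rvDist_pos hμ vT2 hω))
    h.rvMI_T2_S1 hδ
  refine ⟨V₁₂ + V₁ + V₂, fun n hn => ⟨_, fun _ _ _ => Iff.rfl, ?_⟩⟩
  rw [← h.iidExp_eq_aux, add_div, add_div]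
  refine le_trans ?_ (add_le_add (add_le_add (h₁₂ n hn) (h₁ n hn)) (h₂ n hn))
  rw [← iidExp_add, ← iidExp_add]
  refine iidExp_mono hμ fun ω => ?_
  simp only [sum_pi_prod (fun j t => pT (vS1 (ω j)) (vT1 (ω j), t)),
    sum_pi_prod (fun j t => pT (vS1 (ω j)) (t, vT2 (ω j))), Finset.prod_div_distrib,
    Finset.prod_mul_distrib]
  split_ifs <;> first | (exfalso; tauto) | norm_num

/-- Typicality of the auxiliary variables and the channel outputs. -/
lemma exists_decoding_bound (h : JointFactors pS W pT pX1 μ) {δ : ℝ} (hδ : 0 < δ) :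
    ∃ V : ℝ, ∀ n : ℕ, 0 < n → ∃ (D₃ : (Fin n → T₁) → (Fin n → 𝒴₃) → Prop)
      (D₂ : (Fin n → T₂) → (Fin n → 𝒴₂) → Prop),
      (∀ a y, D₃ a y ↔ 2 ^ ((n : ℝ) * (rvMI μ vT1 vY3 - δ)) *
          ((∏ j, rvDist μ vT1 (a j)) * ∏ j, rvDist μ vY3 (y j)) ≤
            ∏ j, rvDist μ (fun ω => (vT1 ω, vY3 ω)) (a j, y j) ∧
          0 < ∏ j, rvDist μ vY3 (y j)) ∧
      (∀ b y, D₂ b y ↔ 2 ^ ((n : ℝ) * (rvMI μ vT2 vY2 - δ)) *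
          ((∏ j, rvDist μ vT2 (b j)) * ∏ j, rvDist μ vY2 (y j)) ≤
            ∏ j, rvDist μ (fun ω => (vT2 ω, vY2 ω)) (b j, y j) ∧
          0 < ∏ j, rvDist μ vY2 (y j)) ∧
      ∑ σ : Fin n → 𝒮 × 𝒮₁, ∑ a : Fin n → T₁, ∑ b : Fin n → T₂, ∑ x : Fin n → 𝒳₁,
        ∑ y : Fin n → 𝒴₂ × 𝒴₃, (∏ j, pS (σ j)) * (∏ j, pT (σ j).2 (a j, b j)) *
          (∏ j, pX1 (a j, b j, (σ j).2) (x j)) * (∏ j, W (x j) (σ j).1 (y j)) *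
          (if D₃ a (fun j => (y j).2) ∧ D₂ b (fun j => (y j).1) then 0 else 1) ≤ V / n := by
  have hμ := h.isPmf
  obtain ⟨V₃, h₃⟩ := iidExp_aep hμ (r := fun ω => rvDist μ (fun ω => (vT1 ω, vY3 ω))
      (vT1 ω, vY3 ω) / (rvDist μ vT1 (vT1 ω) * rvDist μ vY3 (vY3 ω)))
    (fun ω hω => div_pos (rvDist_pos hμ (fun ω => (vT1 ω, vY3 ω)) hω)
      (mul_pos (rvDist_pos hμ vT1 hω) (rvDist_pos hμ vY3 hω))) (rvMI_eq_sum hμ vT1 vY3) hδ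
  obtain ⟨V₂, h₂⟩ := iidExp_aep hμ (r := fun ω => rvDist μ (fun ω => (vT2 ω, vY2 ω))
      (vT2 ω, vY2 ω) / (rvDist μ vT2 (vT2 ω) * rvDist μ vY2 (vY2 ω)))
    (fun ω hω => div_pos (rvDist_pos hμ (fun ω => (vT2 ω, vY2 ω)) hω)
      (mul_pos (rvDist_pos hμ vT2 hω) (rvDist_pos hμ vY2 hω))) (rvMI_eq_sum hμ vT2 vY2) hδ
  refine ⟨V₃ + V₂, fun n hn => ⟨_, _, fun _ _ => Iff.rfl, fun _ _ => Iff.rfl, ?_⟩⟩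
  rw [← h.iidExp_eq, add_div]
  refine le_trans ?_ (add_le_add (h₃ n hn) (h₂ n hn))
  rw [← iidExp_add]
  refine iidExp_mono_support hμ fun ω hω => ?_
  have hpos : ∀ {A : Type} (X : ΩBC 𝒮 𝒮₁ T₁ T₂ 𝒳₁ 𝒴₂ 𝒴₃ → A),
      0 < ∏ j, rvDist μ X (X (ω j)) := fun X =>
    Finset.prod_pos fun j _ => rvDist_pos hμ X (hω j)
  have e₃ := mul_pos (hpos vT1) (hpos vY3)
  have e₂ := mul_pos (hpos vT2) (hpos vY2)
  simp only [Finset.prod_div_distrib, Finset.prod_mul_distrib, le_div_iff₀ e₃,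
    le_div_iff₀ e₂]
  have := hpos vY3
  have := hpos vY2
  split_ifs <;> first | (exfalso; tauto) | norm_num

/-- Random coding bound for `n` channel uses with bins of sizes `L2` and `L3`. -/
lemma exists_code_iid (h : JointFactors pS W pT pX1 μ) {δ η : ℝ} (hδ : 0 < δ) (hη : 0 < η) :
    ∃ V : ℝ, ∀ n : ℕ, 0 < n → ∀ {M2 L2 M3 L3 : ℕ}, 0 < M2 → 0 < L2 → 0 < M3 → 0 < L3 →
      ∃ (enc : Fin M2 → Fin M3 → (Fin n → 𝒮₁) → Fin n → 𝒳₁)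
        (dec2 : (Fin n → 𝒴₂) → Fin M2) (dec3 : (Fin n → 𝒴₃) → Fin M3),
        errProbBC pS W enc dec2 dec3 ≤ V / n +
          (2 ^ ((n : ℝ) * (rvMI μ vT1 vS1 + rvMI μ vT2 vS1 + rvCMI μ vT1 vT2 vS1 + δ)) /
              (L3 * L2) +
            2 ^ ((n : ℝ) * (rvMI μ vT1 vS1 + δ)) / L3 +
            2 ^ ((n : ℝ) * (rvMI μ vT2 vS1 + δ)) / L2) + η +
          M3 * L3 * (2 ^ ((n : ℝ) * (rvMI μ vT1 vY3 - δ)))⁻¹ +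
          M2 * L2 * (2 ^ ((n : ℝ) * (rvMI μ vT2 vY2 - δ)))⁻¹ := by
  have hμ := h.isPmf
  obtain ⟨V₁, hV₁⟩ := h.exists_encoding_bound hδ
  obtain ⟨V₂, hV₂⟩ := h.exists_decoding_bound hδ
  refine ⟨V₁ + V₂ / η, fun n hn M2 L2 M3 L3 hM2 hL2 hM3 hL3 => ?_⟩
  obtain ⟨E, hE, hb₁⟩ := hV₁ n hn
  obtain ⟨D₃, D₂, hD₃, hD₂, hb₂⟩ := hV₂ n hn
  have hpos : ∀ x : ℝ, (0 : ℝ) < 2 ^ x := fun x => Real.rpow_pos_of_pos two_pos x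
  have hT : ∀ s : Fin n → 𝒮₁, ∑ a : Fin n → T₁, ∑ b : Fin n → T₂,
      ∏ j, pT (s j) (a j, b j) = 1 := fun s => by
    rw [Finset.sum_congr rfl fun a _ => sum_pi_prod (fun j t => pT (s j) (a j, t)),
      sum_pi_prod (fun j t => ∑ t2, pT (s j) (t, t2))]
    refine Finset.prod_eq_one fun j _ => ?_
    rw [← Fintype.sum_prod_type (f := pT (s j))]
    exact (h.aux _).2
  have hac : ∀ (σ : Fin n → 𝒮 × 𝒮₁) (a : Fin n → T₁) (b : Fin n → T₂),
      ∏ j, pS (σ j) ≠ 0 → ∏ j, pT (σ j).2 (a j, b j) ≠ 0 →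
      ∏ j, rvDist μ vT1 (a j) ≠ 0 ∧ ∏ j, rvDist μ vT2 (b j) ≠ 0 := fun σ a b hσ hab => by
    have key : ∀ j, rvDist μ vT1 (a j) ≠ 0 ∧ rvDist μ vT2 (b j) ≠ 0 := fun j => by
      obtain ⟨ω, hω, h1, h2⟩ := h.exists_ne_zero (s := (σ j).1) (s1 := (σ j).2)
        (Finset.prod_ne_zero_iff.1 hσ j (mem_univ j))
        (Finset.prod_ne_zero_iff.1 hab j (mem_univ j))
      rw [← h1, ← h2]
      exact ⟨(rvDist_pos hμ vT1 hω).ne', (rvDist_pos hμ vT2 hω).ne'⟩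
    exact ⟨Finset.prod_ne_zero_iff.2 fun j _ => (key j).1,
      Finset.prod_ne_zero_iff.2 fun j _ => (key j).2⟩
  have hθ₃ := sum_likelihood_test_iid_le hμ vT1 vY3 (hpos _) hD₃
  have hθ₂ := sum_likelihood_test_iid_le hμ vT2 vY2 (hpos _) hD₂
  have hS : IsPmf (fun σ : Fin n → 𝒮 × 𝒮₁ => ∏ j, pS (σ j)) := isPmf_prod fun _ => h.state
  have hT0 : ∀ (s : Fin n → 𝒮₁) (a : Fin n → T₁) (b : Fin n → T₂),
      0 ≤ ∏ j, pT (s j) (a j, b j) := fun s a b => Finset.prod_nonneg fun j _ => (h.aux _).1 _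
  have hX : ∀ (s : Fin n → 𝒮₁) (a : Fin n → T₁) (b : Fin n → T₂),
      IsPmf (fun x : Fin n → 𝒳₁ => ∏ j, pX1 (a j, b j, s j) (x j)) := fun s a b =>
    isPmf_prod fun j => h.input (a j, b j, s j)
  have hY : ∀ (x : Fin n → 𝒳₁) (σ : Fin n → 𝒮 × 𝒮₁),
      IsPmf (fun y : Fin n → 𝒴₂ × 𝒴₃ => ∏ j, W (x j) (σ j).1 (y j)) := fun x σ =>
    isPmf_prod fun j => h.channel (x j) (σ j).1
  have hp₁ : IsPmf (fun a : Fin n → T₁ => ∏ j, rvDist μ vT1 (a j)) :=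
    isPmf_prod fun _ => isPmf_rvDist hμ vT1
  have hp₂ : IsPmf (fun b : Fin n → T₂ => ∏ j, rvDist μ vT2 (b j)) :=
    isPmf_prod fun _ => isPmf_rvDist hμ vT2
  have hcode := exists_code_of_information_spectrum (fun (σ : Fin n → 𝒮 × 𝒮₁) j => (σ j).2)
    (fun (y : Fin n → 𝒴₂ × 𝒴₃) j => (y j).1) (fun y j => (y j).2) hS hT0 hT hX hY hp₁ hp₂ hac
    (hpos _).le (hpos _).le (hpos _).le (fun s a b hs => ((hE s a b).1 hs).1)
    (fun s a b hs => ((hE s a b).1 hs).2.1) (fun s a b hs => ((hE s a b).1 hs).2.2) hη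
    (inv_pos.2 (hpos _)).le (inv_pos.2 (hpos _)).le hθ₃ hθ₂ hM2 hL2 hM3 hL3
  obtain ⟨enc, dec2, dec3, hcode⟩ := hcode
  refine ⟨enc, dec2, dec3, le_trans hcode ?_⟩
  have hsplit : (V₁ + V₂ / η) / n = V₁ / n + V₂ / n / η := by
    rw [add_div, div_right_comm]
  rw [hsplit]
  have := div_le_div_of_nonneg_right hb₂ hη.le
  gcongr

end JointFactors

end RandomCoding

lemma exists_nat_rpow_le (n : ℕ) {R : ℝ} (hR : 0 ≤ R) :
    ∃ M : ℕ, (2 : ℝ) ^ ((n : ℝ) * R) ≤ M ∧ (M : ℝ) ≤ 2 * 2 ^ ((n : ℝ) * R) := by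
  refine ⟨⌈(2 : ℝ) ^ ((n : ℝ) * R)⌉₊, Nat.le_ceil _, ?_⟩
  have h1 : (1 : ℝ) ≤ 2 ^ ((n : ℝ) * R) :=
    Real.one_le_rpow (by norm_num) (mul_nonneg n.cast_nonneg hR)
  have := Nat.ceil_lt_add_one (zero_le_one.trans h1)
  linarith

/-- **State-dependent broadcast channel with non-causal partial CSIT.**  If auxiliary
random variables `T₁, T₂` together with `(S, S₁, X₁, Y₂, Y₃)` have a joint pmf
factoring as `p(s,s₁) p(t₁,t₂|s₁) p(x₁|t₁,t₂,s₁) p(y₂,y₃|x₁,s)` and the nonnegative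
rates satisfy
`R13 < I(T₁;Y₃) − I(T₁;S₁)`, `R12 < I(T₂;Y₂) − I(T₂;S₁)`, and
`R13 + R12 < I(T₁;Y₃) + I(T₂;Y₂) − I(T₁;S₁) − I(T₂;S₁) − I(T₁;T₂|S₁)`,
then `(R12, R13)` is achievable. -/
theorem sdbc_noncausal_achievable
    {𝒳₁ 𝒴₂ 𝒴₃ 𝒮 𝒮₁ T₁ T₂ : Type}
    [Fintype 𝒳₁] [Fintype 𝒴₂] [Fintype 𝒴₃] [Fintype 𝒮] [Fintype 𝒮₁]
    [Fintype T₁] [Fintype T₂]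
    (pS : 𝒮 × 𝒮₁ → ℝ) (hpS : IsPmf pS)
    (W : 𝒳₁ → 𝒮 → 𝒴₂ × 𝒴₃ → ℝ) (hW : ∀ x1 s, IsPmf (W x1 s))
    (pT : 𝒮₁ → T₁ × T₂ → ℝ) (hpT : IsKernel pT)
    (pX1 : T₁ × T₂ × 𝒮₁ → 𝒳₁ → ℝ) (hpX1 : IsKernel pX1)
    (μ : ΩBC 𝒮 𝒮₁ T₁ T₂ 𝒳₁ 𝒴₂ 𝒴₃ → ℝ)
    (hμ : ∀ s s1 t1 t2 x1 y2 y3,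
      μ (s, s1, t1, t2, x1, y2, y3) =
        pS (s, s1) * pT s1 (t1, t2) * pX1 (t1, t2, s1) x1 * W x1 s (y2, y3))
    (R12 R13 : ℝ) (hR12 : 0 ≤ R12) (hR13 : 0 ≤ R13)
    (h1 : R13 < rvMI μ vT1 vY3 - rvMI μ vT1 vS1)
    (h2 : R12 < rvMI μ vT2 vY2 - rvMI μ vT2 vS1)
    (h3 : R13 + R12 <
        rvMI μ vT1 vY3 + rvMI μ vT2 vY2
          - rvMI μ vT1 vS1 - rvMI μ vT2 vS1 - rvCMI μ vT1 vT2 vS1) :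
    AchievableBC pS W R12 R13 := by
  intro ε hε
  have h : JointFactors pS W pT pX1 μ := ⟨hpS, hW, hpT, hpX1, hμ⟩
  have hI₁ := rvMI_nonneg h.isPmf vT1 vS1
  have hI₂ := rvMI_nonneg h.isPmf vT2 vS1
  obtain ⟨δ, hδ, hδ₁, hδ₂, hδ₃⟩ : ∃ δ : ℝ, 0 < δ ∧
      rvMI μ vT1 vS1 + 4 * δ ≤ rvMI μ vT1 vY3 - R13 ∧
      rvMI μ vT2 vS1 + 4 * δ ≤ rvMI μ vT2 vY2 - R12 ∧
      rvMI μ vT1 vS1 + rvMI μ vT2 vS1 + rvCMI μ vT1 vT2 vS1 + 6 * δ ≤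
        (rvMI μ vT1 vY3 - R13) + (rvMI μ vT2 vY2 - R12) := by
    refine ⟨min (min (rvMI μ vT1 vY3 - rvMI μ vT1 vS1 - R13)
      (rvMI μ vT2 vY2 - rvMI μ vT2 vS1 - R12)) (rvMI μ vT1 vY3 + rvMI μ vT2 vY2
          - rvMI μ vT1 vS1 - rvMI μ vT2 vS1 - rvCMI μ vT1 vT2 vS1 - (R13 + R12)) / 6, ?_⟩
    set m := min (min (rvMI μ vT1 vY3 - rvMI μ vT1 vS1 - R13)
      (rvMI μ vT2 vY2 - rvMI μ vT2 vS1 - R12)) (rvMI μ vT1 vY3 + rvMI μ vT2 vY2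
          - rvMI μ vT1 vS1 - rvMI μ vT2 vS1 - rvCMI μ vT1 vT2 vS1 - (R13 + R12)) with hm
    have hm0 : 0 < m := lt_min (lt_min (by linarith) (by linarith)) (by linarith)
    have hm1 : m ≤ _ := (min_le_left _ _).trans (min_le_left _ _)
    have hm2 : m ≤ _ := (min_le_left _ _).trans (min_le_right _ _)
    have hm3 : m ≤ _ := min_le_right _ _
    refine ⟨by linarith, ?_, ?_, ?_⟩ <;> linarith
  obtain ⟨V, hV⟩ := h.exists_code_iid hδ (half_pos hε)
  have hpos : ∀ x : ℝ, (0 : ℝ) < 2 ^ x := fun x => Real.rpow_pos_of_pos two_pos x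
  obtain ⟨n, hn, hsmall⟩ : ∃ n : ℕ, 0 < n ∧
      V / n + 11 * (2 : ℝ) ^ (-((n : ℝ) * δ)) ≤ ε / 2 := by
    have t1 : Filter.Tendsto (fun n : ℕ => V / n) Filter.atTop (nhds 0) :=
      tendsto_const_div_atTop_nhds_zero_nat V
    have t2 : Filter.Tendsto (fun n : ℕ => (2 : ℝ) ^ (-((n : ℝ) * δ))) Filter.atTop (nhds 0) := by
      have e : ∀ n : ℕ, (2 : ℝ) ^ (-((n : ℝ) * δ)) = ((2 : ℝ) ^ (-δ)) ^ n := fun n => by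
        rw [← Real.rpow_natCast, ← Real.rpow_mul two_pos.le]
        congr 1
        ring
      simp only [e]
      exact tendsto_pow_atTop_nhds_zero_of_lt_one (hpos _).le
        (Real.rpow_lt_one_of_one_lt_of_neg one_lt_two (neg_lt_zero.2 hδ))
    have t := t1.add (t2.const_mul 11)
    simp only [mul_zero, add_zero] at t
    obtain ⟨n, h1, h2⟩ := ((t.eventually (ge_mem_nhds (half_pos hε))).and
      (Filter.eventually_gt_atTop 0)).exists
    exact ⟨n, h2, h1⟩
  have hn' : (0 : ℝ) ≤ n := n.cast_nonneg
  obtain ⟨M2, hM2, hM2'⟩ := exists_nat_rpow_le n hR12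
  obtain ⟨M3, hM3, hM3'⟩ := exists_nat_rpow_le n hR13
  obtain ⟨L2, hL2, hL2'⟩ := exists_nat_rpow_le n
    (R := rvMI μ vT2 vY2 - R12 - 2 * δ) (by linarith)
  obtain ⟨L3, hL3, hL3'⟩ := exists_nat_rpow_le n
    (R := rvMI μ vT1 vY3 - R13 - 2 * δ) (by linarith)
  have hcast : ∀ {M : ℕ} {x : ℝ}, (2 : ℝ) ^ x ≤ M → 0 < M := fun {M x} hM => by
    exact_mod_cast (hpos x).trans_le hM
  have hcover : ∀ x y K : ℝ, 2 ^ ((n : ℝ) * y) ≤ K → x + 2 * δ ≤ y →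
      2 ^ ((n : ℝ) * (x + δ)) / K ≤ 2 ^ (-((n : ℝ) * δ)) := fun x y K hK hxy => by
    rw [div_le_iff₀ ((hpos _).trans_le hK)]
    refine le_trans ?_ (mul_le_mul_of_nonneg_left hK (hpos _).le)
    rw [← Real.rpow_add two_pos]
    refine Real.rpow_le_rpow_of_exponent_le one_le_two ?_
    nlinarith
  have hpack : ∀ I R M L : ℝ, 0 ≤ L → M ≤ 2 * 2 ^ ((n : ℝ) * R) →
      L ≤ 2 * 2 ^ ((n : ℝ) * (I - R - 2 * δ)) →
      M * L * (2 ^ ((n : ℝ) * (I - δ)))⁻¹ ≤ 4 * 2 ^ (-((n : ℝ) * δ)) :=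
    fun I R M L hL0 hM hL => by
      rw [← div_eq_mul_inv, div_le_iff₀ (hpos _)]
      refine (mul_le_mul hM hL hL0 (mul_pos two_pos (hpos _)).le).trans (le_of_eq ?_)
      rw [mul_mul_mul_comm, mul_assoc 4, ← Real.rpow_add two_pos, ← Real.rpow_add two_pos]
      norm_num
      ring_nf
  obtain ⟨enc, dec2, dec3, hcode⟩ := hV n hn (hcast hM2) (hcast hL2) (hcast hM3) (hcast hL3)
  refine ⟨n, M2, M3, enc, dec2, dec3, hn, hM2, hM3, hcode.trans ?_⟩
  have c₁₂ := hcover (rvMI μ vT1 vS1 + rvMI μ vT2 vS1 + rvCMI μ vT1 vT2 vS1)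
    ((rvMI μ vT1 vY3 - R13 - 2 * δ) + (rvMI μ vT2 vY2 - R12 - 2 * δ)) (L3 * L2) (by
      rw [mul_add, Real.rpow_add two_pos]
      exact mul_le_mul hL3 hL2 (hpos _).le L3.cast_nonneg) (by linarith)
  have c₁ := hcover (rvMI μ vT1 vS1) _ L3 hL3 (by linarith)
  have c₂ := hcover (rvMI μ vT2 vS1) _ L2 hL2 (by linarith)
  have b₃ := hpack _ _ _ _ L3.cast_nonneg hM3' hL3'
  have b₂ := hpack _ _ _ _ L2.cast_nonneg hM2' hL2'
  linarith

end
end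

section
/- (Mutual covering step of the encoding.) Let (S1,T1,T2) have joint pmf p(s1)p(t1,t2|s1) on finite alphabets. Let S1^n be i.i.d. ~ p(s1). Independently of S1^n and of each other, generate codewords T1^n(k) for k∈{1,…,⌈2^{nR1'}⌉}, each i.i.d. according to the marginal p(t1), and codewords T2^n(l) for l∈{1,…,⌈2^{nR2'}⌉}, each i.i.d. according to the marginal p(t2). There exists δ(ε)>0 with δ(ε)→0 as ε→0 such that if R1' > I(T1;S1) + δ(ε), R2' > I(T2;S1) + δ(ε), and R1' + R2' > I(T1;S1) + I(T2;S1) + I(T1;T2|S1) + δ(ε), then the probability that there exists a pair (k,l) with (T1^n(k),T2^n(l),S1^n) jointly strongly ε-typical with respect to p(s1,t1,t2) tends to 1 as n→∞. -/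
/- Statement 10: Mutual covering step of the encoding (equations (7)-(9) of the
paper): two independent i.i.d. codebooks jointly cover an i.i.d. state sequence with
probability tending to one under the rate conditions of the mutual covering lemma. -/

open Finset
open scoped Classical

noncomputable section

/-- Number of occurrences of the symbol `a` in the length-`n` sequence `x`. -/
def nOcc {A : Type} {n : ℕ} (x : Fin n → A) (a : A) : ℕ :=
  (Finset.univ.filter fun j => x j = a).card

/-- Strong `ε`-typicality of the sequence `x` with respect to the pmf `p`:
`|N(a|xⁿ)/n − p a| ≤ ε · p a` for every symbol `a`. -/
def StrongTypical {A : Type} [Fintype A] (p : A → ℝ) (ε : ℝ) {n : ℕ}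
    (x : Fin n → A) : Prop :=
  ∀ a, |((nOcc x a : ℝ)) / n - p a| ≤ ε * p a

section Cover

variable {𝒮₁ T₁ T₂ : Type} [Fintype 𝒮₁] [Fintype T₁] [Fintype T₂]

/-- Marginal pmf of `S₁` under the joint pmf `p` on `𝒮₁ × T₁ × T₂`. -/
def margS1 (p : 𝒮₁ × T₁ × T₂ → ℝ) (s : 𝒮₁) : ℝ := ∑ t : T₁ × T₂, p (s, t.1, t.2)

/-- Marginal pmf of `T₁`. -/
def margT1 (p : 𝒮₁ × T₁ × T₂ → ℝ) (t1 : T₁) : ℝ := ∑ x : 𝒮₁ × T₂, p (x.1, t1, x.2)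

/-- Marginal pmf of `T₂`. -/
def margT2 (p : 𝒮₁ × T₁ × T₂ → ℝ) (t2 : T₂) : ℝ := ∑ x : 𝒮₁ × T₁, p (x.1, x.2, t2)

/-- Probability that some pair of codewords `(T₁ⁿ(k), T₂ⁿ(l))`, generated i.i.d. from
the marginals `p(t₁)` and `p(t₂)` independently of each other and of the i.i.d. state
sequence `S₁ⁿ ∼ p(s₁)`, is jointly strongly `ε`-typical with `S₁ⁿ` w.r.t. the joint
pmf `p(s₁,t₁,t₂)`. -/
def coverProb (p : 𝒮₁ × T₁ × T₂ → ℝ) (ε : ℝ) (n K L : ℕ) : ℝ :=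
  ∑ s : Fin n → 𝒮₁, ∑ c1 : Fin K → Fin n → T₁, ∑ c2 : Fin L → Fin n → T₂,
    if ∃ (k : Fin K) (l : Fin L),
        StrongTypical p ε (fun j => (s j, c1 k j, c2 l j)) then
      (∏ j, margS1 p (s j)) * (∏ k, ∏ j, margT1 p (c1 k j)) *
        (∏ l, ∏ j, margT2 p (c2 l j))
    else 0

end Cover

section Sampling

variable {U V : Type} [Fintype U] [Fintype V]

lemma sum_pi_prod_s10 {ι : Type} [Fintype ι] [DecidableEq ι] (f : ι → U → ℝ) :
    ∑ c : ι → U, ∏ i, f i (c i) = ∏ i, ∑ u, f i u := by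
  rw [Finset.prod_univ_sum, Fintype.piFinset_univ]

lemma sum_pi_prod_eq_one {ι : Type} [Fintype ι] [DecidableEq ι] {a : U → ℝ} (ha : ∑ u, a u = 1) :
    ∑ c : ι → U, ∏ i, a (c i) = 1 := by
  simp [sum_pi_prod_s10 (fun _ : ι => a), ha]

lemma sum_pi_prod_mul {ι : Type} [Fintype ι] [DecidableEq ι] {a : U → ℝ} (ha : ∑ u, a u = 1)
    (k : ι) (g : U → ℝ) :
    ∑ c : ι → U, (∏ i, a (c i)) * g (c k) = ∑ u, a u * g u := by
  have h : ∀ c : ι → U, (∏ i, a (c i)) * g (c k)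
      = ∏ i, (a (c i) * if i = k then g (c i) else 1) := fun c => by
    rw [Finset.prod_mul_distrib, Finset.prod_ite_eq' Finset.univ k]; simp
  simp_rw [h]
  rw [sum_pi_prod_s10 (fun i u => a u * if i = k then g u else 1),
    Finset.prod_eq_single k (fun i _ hi => by simp [hi, ha]) (by simp)]
  simp

lemma sum_pi_prod_mul_mul {ι : Type} [Fintype ι] [DecidableEq ι] {a : U → ℝ} (ha : ∑ u, a u = 1)
    {k l : ι} (hkl : k ≠ l) (g h : U → ℝ) :
    ∑ c : ι → U, (∏ i, a (c i)) * (g (c k) * h (c l))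
      = (∑ u, a u * g u) * ∑ u, a u * h u := by
  have e : ∀ c : ι → U, (∏ i, a (c i)) * (g (c k) * h (c l))
      = ∏ i, (a (c i) * ((if i = k then g (c i) else 1) * if i = l then h (c i) else 1)) :=
    fun c => by
      rw [Finset.prod_mul_distrib, Finset.prod_mul_distrib, Finset.prod_ite_eq' Finset.univ k,
        Finset.prod_ite_eq' Finset.univ l]
      simp
  simp_rw [e]
  rw [sum_pi_prod_s10 (fun i u => a u * ((if i = k then g u else 1) * if i = l then h u else 1)),
    Fintype.prod_eq_mul k l hkl (fun i hi => by simp [hi.1, hi.2, ha])]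
  simp [hkl, hkl.symm]

/-- The expectation of an empirical mean of i.i.d. samples is the mean. -/
lemma empirical_mean {a : U → ℝ} (ha : ∑ u, a u = 1) {K : ℕ} (hK : 0 < K) (g : U → ℝ) :
    ∑ c : Fin K → U, (∏ i, a (c i)) * ((∑ k, g (c k)) / K) = ∑ u, a u * g u := by
  have hK' : (K : ℝ) ≠ 0 := by positivity
  simp_rw [← mul_div_assoc, Finset.mul_sum, ← Finset.sum_div]
  rw [Finset.sum_comm]
  simp_rw [sum_pi_prod_mul ha]
  simp [hK']

/-- The second moment of an empirical mean of i.i.d. samples. -/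
lemma empirical_sq_le {a : U → ℝ} (ha : ∑ u, a u = 1) {K : ℕ} (hK : 0 < K) (g : U → ℝ) :
    ∑ c : Fin K → U, (∏ i, a (c i)) * ((∑ k, g (c k)) / K) ^ 2
      ≤ (∑ u, a u * g u ^ 2) / K + (∑ u, a u * g u) ^ 2 := by
  have hK' : (0 : ℝ) < K := by positivity
  have e : ∑ c : Fin K → U, (∏ i, a (c i)) * ((∑ k, g (c k)) / K) ^ 2
      = (∑ k : Fin K, ∑ l : Fin K,
          ∑ c : Fin K → U, (∏ i, a (c i)) * (g (c k) * g (c l))) / K ^ 2 := by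
    have h : ∀ c : Fin K → U, (∏ i, a (c i)) * ((∑ k, g (c k)) / K) ^ 2
        = (∑ k, ∑ l, (∏ i, a (c i)) * (g (c k) * g (c l))) / K ^ 2 := fun c => by
      rw [div_pow, sq (∑ k, g (c k)), Finset.sum_mul_sum, ← mul_div_assoc]
      simp_rw [Finset.mul_sum]
    simp_rw [h, ← Finset.sum_div]
    rw [Finset.sum_comm]
    congr 1
    exact Finset.sum_congr rfl fun k _ => Finset.sum_comm
  have hkl : ∀ k l : Fin K, ∑ c : Fin K → U, (∏ i, a (c i)) * (g (c k) * g (c l))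
      ≤ (if k = l then ∑ u, a u * g u ^ 2 else 0) + (∑ u, a u * g u) ^ 2 := fun k l => by
    by_cases hkl : k = l
    · subst hkl
      simp_rw [← sq]
      rw [sum_pi_prod_mul ha k (fun u => g u ^ 2)]
      simp [sq_nonneg]
    · rw [sum_pi_prod_mul_mul ha hkl]
      simp [hkl, sq]
  rw [e, div_le_iff₀ (by positivity)]
  refine (Finset.sum_le_sum fun k _ => Finset.sum_le_sum fun l _ => hkl k l).trans ?_
  simp only [Finset.sum_add_distrib, Finset.sum_ite_eq, Finset.mem_univ, if_true,
    Finset.sum_const, Finset.card_univ, Fintype.card_fin, nsmul_eq_mul]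
  apply le_of_eq
  field_simp

/-- First moment of the double empirical mean over two independent codebooks. -/
lemma codebook_mean {a : U → ℝ} {b : V → ℝ} (ha : ∑ u, a u = 1) (hb : ∑ v, b v = 1)
    {K L : ℕ} (hK : 0 < K) (hL : 0 < L) (f : U → V → ℝ) :
    ∑ c : Fin K → U, ∑ d : Fin L → V, (∏ i, a (c i)) * (∏ i, b (d i)) *
        ((∑ k, (∑ l, f (c k) (d l)) / L) / K)
      = ∑ u, a u * ∑ v, b v * f u v := by
  rw [Finset.sum_comm]
  have h : ∀ d : Fin L → V, ∑ c : Fin K → U, (∏ i, a (c i)) * (∏ i, b (d i)) *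
        ((∑ k, (∑ l, f (c k) (d l)) / L) / K)
      = ∑ u, a u * ((∏ i, b (d i)) * ((∑ l, f u (d l)) / L)) := fun d => by
    rw [← empirical_mean ha hK (fun u => (∏ i, b (d i)) * ((∑ l, f u (d l)) / L))]
    refine Finset.sum_congr rfl fun c _ => ?_
    rw [← Finset.mul_sum]; ring
  simp_rw [h]
  rw [Finset.sum_comm]
  simp_rw [← Finset.mul_sum, empirical_mean hb hL]

/-- Second moment of the double empirical mean over two independent codebooks. -/
lemma codebook_sq_le {a : U → ℝ} {b : V → ℝ} (ha : IsPmf a) (hb : IsPmf b)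
    {K L : ℕ} (hK : 0 < K) (hL : 0 < L) (f : U → V → ℝ) :
    ∑ c : Fin K → U, ∑ d : Fin L → V, (∏ i, a (c i)) * (∏ i, b (d i)) *
        ((∑ k, (∑ l, f (c k) (d l)) / L) / K) ^ 2
      ≤ (∑ u, a u * ∑ v, b v * f u v ^ 2) / (K * L)
        + (∑ u, a u * (∑ v, b v * f u v) ^ 2) / K
        + (∑ v, b v * (∑ u, a u * f u v) ^ 2) / L
        + (∑ u, a u * ∑ v, b v * f u v) ^ 2 := by
  have hb0 : ∀ d : Fin L → V, 0 ≤ ∏ i, b (d i) := fun d => Finset.prod_nonneg fun i _ => hb.1 _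
  rw [Finset.sum_comm]
  have h : ∀ d : Fin L → V, ∑ c : Fin K → U, (∏ i, a (c i)) * (∏ i, b (d i)) *
        ((∑ k, (∑ l, f (c k) (d l)) / L) / K) ^ 2
      ≤ (∏ i, b (d i)) * ((∑ u, a u * ((∑ l, f u (d l)) / L) ^ 2) / K
          + ((∑ l, ∑ u, a u * f u (d l)) / L) ^ 2) := fun d => by
    have e : (∑ l, ∑ u, a u * f u (d l)) / L = ∑ u, a u * ((∑ l, f u (d l)) / L) := by
      rw [Finset.sum_comm, Finset.sum_div]
      exact Finset.sum_congr rfl fun u _ => by rw [← Finset.mul_sum, mul_div_assoc]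
    rw [e]
    refine le_of_eq_of_le ?_ (mul_le_mul_of_nonneg_left
      (empirical_sq_le ha.2 hK (fun u => (∑ l, f u (d l)) / L)) (hb0 d))
    rw [Finset.mul_sum]
    exact Finset.sum_congr rfl fun c _ => by ring
  refine (Finset.sum_le_sum fun d _ => h d).trans ?_
  simp_rw [mul_add, Finset.sum_add_distrib]
  have h1 : ∑ d : Fin L → V, (∏ i, b (d i)) * ((∑ u, a u * ((∑ l, f u (d l)) / L) ^ 2) / K)
      ≤ (∑ u, a u * ((∑ v, b v * f u v ^ 2) / L + (∑ v, b v * f u v) ^ 2)) / K := by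
    simp_rw [← mul_div_assoc, ← Finset.sum_div, Finset.mul_sum]
    rw [Finset.sum_comm]
    gcongr with u
    simp_rw [mul_left_comm _ (a u), ← Finset.mul_sum]
    exact mul_le_mul_of_nonneg_left (empirical_sq_le hb.2 hL (f u)) (ha.1 u)
  have h2 := empirical_sq_le hb.2 hL (fun v => ∑ u, a u * f u v)
  have h3 : ∑ v, b v * ∑ u, a u * f u v = ∑ u, a u * ∑ v, b v * f u v := by
    simp_rw [Finset.mul_sum]
    rw [Finset.sum_comm]
    exact Finset.sum_congr rfl fun u _ => Finset.sum_congr rfl fun v _ => by ring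
  rw [h3] at h2
  have h4 : (∑ u, a u * ((∑ v, b v * f u v ^ 2) / L + (∑ v, b v * f u v) ^ 2)) / K
      = (∑ u, a u * ∑ v, b v * f u v ^ 2) / (K * L)
        + (∑ u, a u * (∑ v, b v * f u v) ^ 2) / K := by
    simp_rw [mul_add, Finset.sum_add_distrib, ← mul_div_assoc, ← Finset.sum_div]
    rw [add_div, div_div, mul_comm (L : ℝ)]
  linarith

end Sampling

section OneShot

variable {S U V : Type} [Fintype S] [Fintype U] [Fintype V]

/-- For a fixed state, the probability that no pair of codewords falls in `A`, bounded through the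
likelihood ratio `q / (a b)` restricted to `A`. -/
lemma one_shot_fixed_state {a : U → ℝ} {b : V → ℝ} (ha : IsPmf a) (hb : IsPmf b)
    {q : U → V → ℝ} (hq : ∀ u v, 0 ≤ q u v) (hq1 : ∑ u, ∑ v, q u v = 1)
    {A : U → V → Prop} (hA : ∀ u v, A u v → 0 < a u ∧ 0 < b v) {M M₁ M₂ : ℝ}
    (hM : ∀ u v, A u v → q u v ≤ M * (a u * b v))
    (hM₁ : ∀ u v, A u v → ∑ v', q u v' ≤ M₁ * a u)
    (hM₂ : ∀ u v, A u v → ∑ u', q u' v ≤ M₂ * b v) {K L : ℕ} (hK : 0 < K) (hL : 0 < L) :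
    ∑ c : Fin K → U, ∑ d : Fin L → V,
        (if ∃ k l, A (c k) (d l) then 0 else (∏ i, a (c i)) * (∏ i, b (d i)))
      ≤ (M / (K * L) + M₁ / K + M₂ / L) * (∑ u, ∑ v, if A u v then q u v else 0)
        + 1 - ∑ u, ∑ v, if A u v then q u v else 0 := by
  set f : U → V → ℝ := fun u v => if A u v then q u v / (a u * b v) else 0 with hf
  set π : ℝ := ∑ u, ∑ v, if A u v then q u v else 0 with hπ
  have hite : ∀ u v, 0 ≤ (if A u v then q u v else 0) := fun u v => by
    split_ifs
    exacts [hq u v, le_rfl]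
  have hite' : ∀ u v, (if A u v then q u v else 0) ≤ q u v := fun u v => by
    split_ifs
    exacts [le_rfl, hq u v]
  have hfab : ∀ u v, a u * (b v * f u v) = if A u v then q u v else 0 := fun u v => by
    simp only [hf]
    split_ifs with h
    · have := (hA u v h).1.ne'
      have := (hA u v h).2.ne'
      field_simp
    · simp
  have hf0 : ∀ u v, 0 ≤ f u v := fun u v => by
    simp only [hf]
    split_ifs
    exacts [div_nonneg (hq u v) (mul_nonneg (ha.1 u) (hb.1 v)), le_rfl]
  have hmean : ∑ u, a u * ∑ v, b v * f u v = π := by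
    simp_rw [Finset.mul_sum, hfab, hπ]
  have hmean' : ∑ v, b v * ∑ u, a u * f u v = π := by
    simp_rw [Finset.mul_sum, mul_left_comm (b _), hfab, hπ]
    exact Finset.sum_comm
  have hπ0 : 0 ≤ π := Finset.sum_nonneg fun u _ => Finset.sum_nonneg fun v _ => hite u v
  have hπ1 : π ≤ 1 := hq1 ▸ Finset.sum_le_sum fun u _ => Finset.sum_le_sum fun v _ => hite' u v
  have h12 : ∑ u, a u * ∑ v, b v * f u v ^ 2 ≤ M * π := by
    rw [← hmean]
    simp_rw [Finset.mul_sum]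
    refine Finset.sum_le_sum fun u _ => Finset.sum_le_sum fun v _ => ?_
    have : f u v ^ 2 ≤ M * f u v := by
      rw [sq]
      by_cases h : A u v
      · refine mul_le_mul_of_nonneg_right ?_ (hf0 u v)
        simp only [hf, if_pos h]
        rw [div_le_iff₀ (mul_pos (hA u v h).1 (hA u v h).2)]
        exact hM u v h
      · simp [hf, h]
    calc a u * (b v * f u v ^ 2) ≤ a u * (b v * (M * f u v)) :=
          mul_le_mul_of_nonneg_left (mul_le_mul_of_nonneg_left this (hb.1 v)) (ha.1 u)
      _ = _ := by ring
  have h1 : ∑ u, a u * (∑ v, b v * f u v) ^ 2 ≤ M₁ * π := by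
    rw [← hmean, Finset.mul_sum]
    refine Finset.sum_le_sum fun u _ => ?_
    rw [mul_left_comm]
    refine mul_le_mul_of_nonneg_left ?_ (ha.1 u)
    rw [sq]
    by_cases h : ∃ v, A u v
    · obtain ⟨v, h⟩ := h
      refine mul_le_mul_of_nonneg_right ?_
        (Finset.sum_nonneg fun v _ => mul_nonneg (hb.1 v) (hf0 u v))
      have hau := (hA u v h).1
      refine le_of_mul_le_mul_left ?_ hau
      rw [Finset.mul_sum]
      simp_rw [hfab]
      rw [mul_comm (a u)]
      exact (Finset.sum_le_sum fun v _ => hite' u v).trans (hM₁ u v h)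
    · push Not at h
      simp [hf, h]
  have h2 : ∑ v, b v * (∑ u, a u * f u v) ^ 2 ≤ M₂ * π := by
    rw [← hmean', Finset.mul_sum]
    refine Finset.sum_le_sum fun v _ => ?_
    rw [mul_left_comm]
    refine mul_le_mul_of_nonneg_left ?_ (hb.1 v)
    rw [sq]
    by_cases h : ∃ u, A u v
    · obtain ⟨u, h⟩ := h
      refine mul_le_mul_of_nonneg_right ?_
        (Finset.sum_nonneg fun u _ => mul_nonneg (ha.1 u) (hf0 u v))
      refine le_of_mul_le_mul_left ?_ (hA u v h).2
      rw [Finset.mul_sum]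
      simp_rw [mul_left_comm (b _), hfab]
      rw [mul_comm (b v)]
      exact (Finset.sum_le_sum fun u _ => hite' u v).trans (hM₂ u v h)
    · push Not at h
      simp [hf, h]
  have hsq := codebook_sq_le ha hb hK hL f
  have hfst := codebook_mean ha.2 hb.2 hK hL f
  rw [hmean] at hsq hfst
  have hone : ∑ c : Fin K → U, ∑ d : Fin L → V, (∏ i, a (c i)) * (∏ i, b (d i)) = 1 := by
    simp_rw [← Finset.mul_sum, sum_pi_prod_eq_one hb.2, mul_one, sum_pi_prod_eq_one ha.2]
  have hle : ∑ c : Fin K → U, ∑ d : Fin L → V,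
        (if ∃ k l, A (c k) (d l) then 0 else (∏ i, a (c i)) * (∏ i, b (d i)))
      ≤ ∑ c : Fin K → U, ∑ d : Fin L → V, ((∏ i, a (c i)) * (∏ i, b (d i)) *
          ((∑ k, (∑ l, f (c k) (d l)) / L) / K) ^ 2
        - 2 * ((∏ i, a (c i)) * (∏ i, b (d i)) * ((∑ k, (∑ l, f (c k) (d l)) / L) / K))
        + (∏ i, a (c i)) * (∏ i, b (d i))) := by
    refine Finset.sum_le_sum fun c _ => Finset.sum_le_sum fun d _ => ?_
    have hw : 0 ≤ (∏ i, a (c i)) * (∏ i, b (d i)) :=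
      mul_nonneg (Finset.prod_nonneg fun i _ => ha.1 _) (Finset.prod_nonneg fun i _ => hb.1 _)
    split_ifs with h
    · nlinarith [mul_nonneg hw (sq_nonneg (((∑ k, (∑ l, f (c k) (d l)) / L) / K) - 1))]
    · push Not at h
      simp [hf, h]
  simp_rw [Finset.sum_add_distrib, Finset.sum_sub_distrib, ← Finset.mul_sum] at hle
  simp_rw [← Finset.mul_sum] at hone hfst hsq
  rw [hfst, hone] at hle
  refine hle.trans ?_
  have hK' : (0 : ℝ) < K := by positivity
  have hL' : (0 : ℝ) < L := by positivity
  have e1 := div_le_div_of_nonneg_right h12 (mul_pos hK' hL').le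
  have e2 := div_le_div_of_nonneg_right h1 hK'.le
  have e3 := div_le_div_of_nonneg_right h2 hL'.le
  have e4 : π ^ 2 ≤ π := by nlinarith
  have e5 : (M / (K * L) + M₁ / K + M₂ / L) * π = M * π / (K * L) + M₁ * π / K + M₂ * π / L := by
    ring
  linarith

/-- One-shot mutual covering: a random state and two independent codebooks. -/
lemma one_shot_covering {μ : S → ℝ} {a : U → ℝ} {b : V → ℝ} (ha : IsPmf a) (hb : IsPmf b)
    {P : S → U → V → ℝ} (hP : ∀ s u v, 0 ≤ P s u v) (hPμ : ∀ s, ∑ u, ∑ v, P s u v = μ s)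
    (hμ : ∑ s, μ s = 1) {A : S → U → V → Prop}
    (hA : ∀ s u v, A s u v → 0 < a u ∧ 0 < b v) {M M₁ M₂ : ℝ}
    (hM0 : 0 ≤ M) (hM₁0 : 0 ≤ M₁) (hM₂0 : 0 ≤ M₂)
    (hM : ∀ s u v, A s u v → P s u v ≤ M * (μ s * a u * b v))
    (hM₁ : ∀ s u v, A s u v → ∑ v', P s u v' ≤ M₁ * (μ s * a u))
    (hM₂ : ∀ s u v, A s u v → ∑ u', P s u' v ≤ M₂ * (μ s * b v))
    {K L : ℕ} (hK : 0 < K) (hL : 0 < L) :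
    ∑ s, ∑ c : Fin K → U, ∑ d : Fin L → V,
        (if ∃ k l, A s (c k) (d l) then 0 else μ s * (∏ i, a (c i)) * (∏ i, b (d i)))
      ≤ M / (K * L) + M₁ / K + M₂ / L
        + 1 - ∑ s, ∑ u, ∑ v, if A s u v then P s u v else 0 := by
  set π : S → ℝ := fun s => ∑ u, ∑ v, if A s u v then P s u v else 0 with hπ
  set B : ℝ := M / (K * L) + M₁ / K + M₂ / L with hB
  have hB0 : 0 ≤ B := by positivity
  have hμ0 : ∀ s, 0 ≤ μ s := fun s => hPμ s ▸
    Finset.sum_nonneg fun u _ => Finset.sum_nonneg fun v _ => hP s u v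
  have hπμ : ∀ s, π s ≤ μ s := fun s => hPμ s ▸
    Finset.sum_le_sum fun u _ => Finset.sum_le_sum fun v _ => by
      split_ifs
      exacts [le_rfl, hP s u v]
  have key : ∀ s, ∑ c : Fin K → U, ∑ d : Fin L → V,
        (if ∃ k l, A s (c k) (d l) then 0 else μ s * (∏ i, a (c i)) * (∏ i, b (d i)))
      ≤ B * π s + μ s - π s := fun s => by
    rcases (hμ0 s).eq_or_lt with h0 | h0
    · have hπ0 : π s = 0 := by
        refine le_antisymm (h0 ▸ hπμ s) (Finset.sum_nonneg fun u _ =>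
          Finset.sum_nonneg fun v _ => ?_)
        split_ifs
        exacts [hP s u v, le_rfl]
      simp [← h0, hπ0]
    · have h := one_shot_fixed_state (q := fun u v => P s u v / μ s) (A := A s) (M := M)
        (M₁ := M₁) (M₂ := M₂) ha hb (fun u v => div_nonneg (hP s u v) h0.le)
        (by simp_rw [← Finset.sum_div, hPμ s]; exact div_self h0.ne') (hA s)
        (fun u v huv => by
          rw [div_le_iff₀ h0]
          exact (hM s u v huv).trans_eq (by ring))
        (fun u v huv => by
          rw [← Finset.sum_div, div_le_iff₀ h0]
          exact (hM₁ s u v huv).trans_eq (by ring))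
        (fun u v huv => by
          rw [← Finset.sum_div, div_le_iff₀ h0]
          exact (hM₂ s u v huv).trans_eq (by ring)) hK hL
      have e : ∑ u, ∑ v, (if A s u v then P s u v / μ s else 0) = π s / μ s := by
        simp_rw [hπ, Finset.sum_div]
        refine Finset.sum_congr rfl fun u _ => Finset.sum_congr rfl fun v _ => ?_
        split_ifs <;> simp
      rw [e] at h
      have h' := mul_le_mul_of_nonneg_left h h0.le
      simp_rw [Finset.mul_sum, mul_ite, mul_zero, ← mul_assoc] at h'
      refine h'.trans_eq ?_
      rw [← hB]
      field_simp
  refine (Finset.sum_le_sum fun s _ => key s).trans ?_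
  rw [Finset.sum_sub_distrib, Finset.sum_add_distrib, ← Finset.mul_sum, hμ]
  have : ∑ s, π s ≤ 1 := hμ ▸ Finset.sum_le_sum fun s _ => hπμ s
  nlinarith

end OneShot

section Typical

variable {Ω : Type} [Fintype Ω] {p : Ω → ℝ} {ε : ℝ} {n : ℕ}

lemma sum_eq_sum_nOcc (x : Fin n → Ω) (g : Ω → ℝ) :
    ∑ j, g (x j) = ∑ a, (nOcc x a : ℝ) * g a := by
  rw [← Finset.sum_fiberwise (s := Finset.univ) (g := x)]
  refine Finset.sum_congr rfl fun a _ => ?_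
  rw [Finset.sum_congr rfl (g := fun _ => g a) fun j hj => by rw [(Finset.mem_filter.1 hj).2],
    Finset.sum_const, nsmul_eq_mul]
  rfl

lemma StrongTypical.mono (hp : IsPmf p) {ε' : ℝ} (h : ε' ≤ ε) {x : Fin n → Ω}
    (hx : StrongTypical p ε' x) : StrongTypical p ε x := fun a =>
  (hx a).trans (mul_le_mul_of_nonneg_right h (hp.1 a))

lemma StrongTypical.pos (hp : IsPmf p) {x : Fin n → Ω} (hx : StrongTypical p ε x) (j : Fin n) :
    0 < p (x j) := by
  refine (hp.1 _).lt_of_ne fun h0 => ?_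
  have h := hx (x j)
  have hn : (0 : ℝ) < n := by exact_mod_cast j.pos
  have hocc : (0 : ℝ) < nOcc x (x j) := by
    exact_mod_cast Finset.card_pos.2 ⟨j, by simp⟩
  rw [← h0, mul_zero, sub_zero, abs_of_pos (div_pos hocc hn)] at h
  exact absurd (div_pos hocc hn) (not_lt.2 h)

lemma StrongTypical.sum_le {x : Fin n → Ω} (hx : StrongTypical p ε x) (g : Ω → ℝ) :
    ∑ j, g (x j) ≤ n * (∑ a, p a * g a + ε * ∑ a, p a * |g a|) := by
  rcases Nat.eq_zero_or_pos n with rfl | hn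
  · simp
  have hn' : (0 : ℝ) < n := by exact_mod_cast hn
  rw [sum_eq_sum_nOcc, Finset.mul_sum, ← Finset.sum_add_distrib, Finset.mul_sum]
  refine Finset.sum_le_sum fun a _ => ?_
  have h : (nOcc x a / n - p a) * g a ≤ ε * p a * |g a| :=
    (le_abs_self _).trans (by
      rw [abs_mul]
      exact mul_le_mul_of_nonneg_right (hx a) (abs_nonneg _))
  have e : (nOcc x a : ℝ) * g a = n * (p a * g a + (nOcc x a / n - p a) * g a) := by
    field_simp
    ring
  rw [e]
  refine mul_le_mul_of_nonneg_left ?_ hn'.le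
  linarith

/-- On a typical sequence, a product likelihood ratio is at most exponential in the mean of the
log-likelihood ratio. -/
lemma StrongTypical.prod_le (hp : IsPmf p) {x : Fin n → Ω} (hx : StrongTypical p ε x)
    {f g : Ω → ℝ} (hf : ∀ ω, 0 < p ω → 0 < f ω) (hg : ∀ ω, 0 < p ω → 0 < g ω) :
    ∏ j, f (x j) ≤ (2 : ℝ) ^ ((n : ℝ) * (∑ ω, p ω * Real.logb 2 (f ω / g ω)
      + ε * ∑ ω, p ω * |Real.logb 2 (f ω / g ω)|)) * ∏ j, g (x j) := by
  have hg' : 0 < ∏ j, g (x j) := Finset.prod_pos fun j _ => hg _ (hx.pos hp j)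
  rw [← div_le_iff₀ hg', ← Finset.prod_div_distrib]
  have e : ∏ j, f (x j) / g (x j) = (2 : ℝ) ^ (∑ j, Real.logb 2 (f (x j) / g (x j))) := by
    rw [Real.rpow_sum_of_pos two_pos]
    refine Finset.prod_congr rfl fun j _ => ?_
    rw [Real.rpow_logb two_pos (by norm_num)
      (div_pos (hf _ (hx.pos hp j)) (hg _ (hx.pos hp j)))]
  rw [e]
  exact Real.rpow_le_rpow_of_exponent_le one_le_two
    (hx.sum_le fun ω => Real.logb 2 (f ω / g ω))

/-- Chebyshev bound for the probability of a deviating empirical frequency. -/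
lemma sum_nOcc_deviation_le (hp : IsPmf p) (hn : 0 < n) (a : Ω) (hε : 0 < ε) :
    ∑ x : Fin n → Ω, (if |(nOcc x a : ℝ) / n - p a| ≤ ε * p a then 0 else ∏ j, p (x j))
      ≤ (1 / (ε * p a) ^ 2) / n := by
  have hn' : (0 : ℝ) < n := by exact_mod_cast hn
  rcases (hp.1 a).eq_or_lt with h0 | h0
  · refine (Finset.sum_nonpos fun x _ => ?_).trans (by positivity)
    split_ifs with h
    · exact le_rfl
    · by_cases hx : ∃ j, x j = a
      · obtain ⟨j, hj⟩ := hx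
        exact (Finset.prod_eq_zero (Finset.mem_univ j) (by rw [hj, ← h0])).le
      · push Not at hx
        exact absurd (by simp [nOcc, hx, ← h0]) h
  · have hpa : 0 < ε * p a := mul_pos hε h0
    have hpa1 : p a ≤ 1 := hp.2 ▸ Finset.single_le_sum (fun b _ => hp.1 b) (Finset.mem_univ a)
    set g : Ω → ℝ := fun b => (if b = a then 1 else 0) - p a with hg
    have hmean : ∑ b, p b * g b = 0 := by
      simp [hg, mul_sub, Finset.sum_sub_distrib, ← Finset.sum_mul, hp.2]
    have hsq : ∑ b, p b * g b ^ 2 ≤ 1 := by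
      rw [← hp.2]
      refine Finset.sum_le_sum fun b _ => mul_le_of_le_one_right (hp.1 b) ?_
      simp only [hg]
      split_ifs <;> nlinarith
    have hfreq : ∀ x : Fin n → Ω, (nOcc x a : ℝ) / n - p a = (∑ j, g (x j)) / n := fun x => by
      simp only [hg, Finset.sum_sub_distrib, nOcc]
      simp
      field_simp
    have hemp := empirical_sq_le hp.2 hn g
    rw [hmean] at hemp
    calc _ ≤ ∑ x : Fin n → Ω, (∏ j, p (x j)) * ((∑ j, g (x j)) / n) ^ 2 / (ε * p a) ^ 2 := by
          refine Finset.sum_le_sum fun x _ => ?_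
          have hw : 0 ≤ ∏ j, p (x j) := Finset.prod_nonneg fun j _ => hp.1 _
          split_ifs with h
          · positivity
          · rw [hfreq] at h
            rw [mul_div_assoc]
            refine le_mul_of_one_le_right hw ((one_le_div (by positivity)).2 ?_)
            rw [← sq_abs ((∑ j, g (x j)) / n)]
            exact pow_le_pow_left₀ hpa.le (not_le.1 h).le 2
      _ ≤ (1 / n) / (ε * p a) ^ 2 := by
          rw [← Finset.sum_div]
          refine div_le_div_of_nonneg_right (hemp.trans ?_) (by positivity)
          simp only [ne_eq, OfNat.ofNat_ne_zero, not_false_eq_true, zero_pow, add_zero]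
          exact div_le_div_of_nonneg_right hsq hn'.le
      _ = _ := div_right_comm _ _ _

lemma one_sub_le_sum_typical (hp : IsPmf p) (hn : 0 < n) (hε : 0 < ε) :
    1 - (∑ a, 1 / (ε * p a) ^ 2) / n
      ≤ ∑ x : Fin n → Ω, if StrongTypical p ε x then ∏ j, p (x j) else 0 := by
  have h1 : ∑ x : Fin n → Ω, ∏ j, p (x j) = 1 := sum_pi_prod_eq_one hp.2
  rw [Finset.sum_div, sub_le_iff_le_add]
  refine h1.symm.le.trans (le_trans ?_ (add_le_add_right
    (Finset.sum_le_sum fun a _ => sum_nOcc_deviation_le hp hn a hε) _))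
  rw [Finset.sum_comm, ← Finset.sum_add_distrib]
  refine Finset.sum_le_sum fun x _ => ?_
  have hw : 0 ≤ ∏ j, p (x j) := Finset.prod_nonneg fun j _ => hp.1 _
  have hite : ∀ a, 0 ≤ if |(nOcc x a : ℝ) / n - p a| ≤ ε * p a then 0 else ∏ j, p (x j) :=
    fun a => by
      split_ifs
      exacts [le_rfl, hw]
  by_cases h : StrongTypical p ε x
  · rw [if_pos h]
    exact le_add_of_nonneg_right (Finset.sum_nonneg fun a _ => hite a)
  · rw [if_neg h, zero_add]
    simp only [StrongTypical, not_forall] at h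
    obtain ⟨a, ha⟩ := h
    refine le_trans ?_ (Finset.single_le_sum (fun a _ => hite a) (Finset.mem_univ a))
    rw [if_neg ha]

end Typical

section Information

lemma rvEnt_eq {Ω A : Type} [Fintype Ω] [Fintype A] (μ : Ω → ℝ) (X : Ω → A) :
    rvEnt μ X = -∑ ω, μ ω * Real.logb 2 (rvDist μ X (X ω)) := by
  simp only [rvEnt]
  congr 1
  simp_rw [rvDist, Finset.sum_mul]
  rw [Finset.sum_comm]
  refine Finset.sum_congr rfl fun ω _ => ?_
  rw [Finset.sum_eq_single (X ω) (fun a _ ha => by simp [ha.symm]) (by simp)]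
  simp

variable {𝒮₁ T₁ T₂ : Type} [Fintype 𝒮₁] [Fintype T₁] [Fintype T₂]
  {p : 𝒮₁ × T₁ × T₂ → ℝ}

lemma rvDist_fst (s : 𝒮₁) : rvDist p (fun ω => ω.1) s = margS1 p s := by
  simp only [rvDist, margS1, Fintype.sum_prod_type]
  rw [Finset.sum_eq_single s (fun b _ hb => by simp [hb]) (by simp)]
  simp

lemma rvDist_snd_fst (u : T₁) : rvDist p (fun ω => ω.2.1) u = margT1 p u := by
  simp only [rvDist, margT1, Fintype.sum_prod_type]
  refine Finset.sum_congr rfl fun s _ => ?_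
  rw [Finset.sum_eq_single u (fun b _ hb => by simp [hb]) (by simp)]
  simp

lemma rvDist_snd_snd (v : T₂) : rvDist p (fun ω => ω.2.2) v = margT2 p v := by
  simp only [rvDist, margT2, Fintype.sum_prod_type]
  simp

lemma rvDist_snd_fst_fst (s : 𝒮₁) (u : T₁) :
    rvDist p (fun ω => (ω.2.1, ω.1)) (u, s) = ∑ v, p (s, u, v) := by
  simp only [rvDist, Fintype.sum_prod_type]
  rw [Finset.sum_eq_single s (fun b _ hb => by simp [hb]) (by simp),
    Finset.sum_eq_single u (fun b _ hb => by simp [hb]) (by simp)]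
  simp

lemma rvDist_snd_snd_fst (s : 𝒮₁) (v : T₂) :
    rvDist p (fun ω => (ω.2.2, ω.1)) (v, s) = ∑ u, p (s, u, v) := by
  simp only [rvDist, Fintype.sum_prod_type]
  rw [Finset.sum_eq_single s (fun b _ hb => by simp [hb]) (by simp)]
  simp

lemma rvDist_perm (s : 𝒮₁) (u : T₁) (v : T₂) :
    rvDist p (fun ω => (ω.2.1, ω.2.2, ω.1)) (u, v, s) = p (s, u, v) := by
  simp only [rvDist]
  rw [Finset.sum_eq_single (s, u, v) (fun b _ hb => ?_) (by simp)]
  · simp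
  · rw [if_neg]
    rintro h
    simp only [Prod.mk.injEq] at h
    exact hb (by ext <;> simp [h])

lemma sum_margS1 (hp : IsPmf p) : ∑ s, margS1 p s = 1 := by
  simp_rw [margS1, ← hp.2, Fintype.sum_prod_type]

lemma isPmf_margT1 (hp : IsPmf p) : IsPmf (margT1 p) := by
  refine ⟨fun u => Finset.sum_nonneg fun _ _ => hp.1 _, ?_⟩
  simp_rw [margT1, ← hp.2, Fintype.sum_prod_type]
  exact Finset.sum_comm

lemma isPmf_margT2 (hp : IsPmf p) : IsPmf (margT2 p) := by
  refine ⟨fun u => Finset.sum_nonneg fun _ _ => hp.1 _, ?_⟩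
  simp_rw [margT2, ← hp.2, Fintype.sum_prod_type]
  rw [Finset.sum_comm]
  exact Finset.sum_congr rfl fun s _ => Finset.sum_comm

lemma margS1_pos (hp : IsPmf p) {ω : 𝒮₁ × T₁ × T₂} (h : 0 < p ω) : 0 < margS1 p ω.1 :=
  h.trans_le (Finset.single_le_sum (f := fun t : T₁ × T₂ => p (ω.1, t.1, t.2))
    (fun _ _ => hp.1 _) (Finset.mem_univ ω.2))

lemma margT1_pos (hp : IsPmf p) {ω : 𝒮₁ × T₁ × T₂} (h : 0 < p ω) : 0 < margT1 p ω.2.1 :=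
  h.trans_le (Finset.single_le_sum (f := fun x : 𝒮₁ × T₂ => p (x.1, ω.2.1, x.2))
    (fun _ _ => hp.1 _) (Finset.mem_univ (ω.1, ω.2.2)))

lemma margT2_pos (hp : IsPmf p) {ω : 𝒮₁ × T₁ × T₂} (h : 0 < p ω) : 0 < margT2 p ω.2.2 :=
  h.trans_le (Finset.single_le_sum (f := fun x : 𝒮₁ × T₁ => p (x.1, x.2, ω.2.2))
    (fun _ _ => hp.1 _) (Finset.mem_univ (ω.1, ω.2.1)))

lemma sum_snd_pos (hp : IsPmf p) {ω : 𝒮₁ × T₁ × T₂} (h : 0 < p ω) :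
    0 < ∑ v, p (ω.1, ω.2.1, v) :=
  h.trans_le (Finset.single_le_sum (f := fun v => p (ω.1, ω.2.1, v))
    (fun _ _ => hp.1 _) (Finset.mem_univ ω.2.2))

lemma sum_fst_pos (hp : IsPmf p) {ω : 𝒮₁ × T₁ × T₂} (h : 0 < p ω) :
    0 < ∑ u, p (ω.1, u, ω.2.2) :=
  h.trans_le (Finset.single_le_sum (f := fun u => p (ω.1, u, ω.2.2))
    (fun _ _ => hp.1 _) (Finset.mem_univ ω.2.1))

lemma rvMI_T1_eq (hp : IsPmf p) :
    rvMI p (fun ω => ω.2.1) (fun ω => ω.1) = ∑ ω, p ω * Real.logb 2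
      ((∑ v, p (ω.1, ω.2.1, v)) / (margS1 p ω.1 * margT1 p ω.2.1)) := by
  simp only [rvMI, rvEnt_eq, rvDist_fst, rvDist_snd_fst, rvDist_snd_fst_fst,
    ← Finset.sum_neg_distrib, ← Finset.sum_add_distrib, ← Finset.sum_sub_distrib]
  refine Finset.sum_congr rfl fun ω _ => ?_
  rcases (hp.1 ω).eq_or_lt with h | h
  · simp [← h]
  · rw [Real.logb_div (sum_snd_pos hp h).ne' (mul_pos (margS1_pos hp h) (margT1_pos hp h)).ne',
      Real.logb_mul (margS1_pos hp h).ne' (margT1_pos hp h).ne']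
    ring

lemma rvMI_T2_eq (hp : IsPmf p) :
    rvMI p (fun ω => ω.2.2) (fun ω => ω.1) = ∑ ω, p ω * Real.logb 2
      ((∑ u, p (ω.1, u, ω.2.2)) / (margS1 p ω.1 * margT2 p ω.2.2)) := by
  simp only [rvMI, rvEnt_eq, rvDist_fst, rvDist_snd_snd, rvDist_snd_snd_fst,
    ← Finset.sum_neg_distrib, ← Finset.sum_add_distrib, ← Finset.sum_sub_distrib]
  refine Finset.sum_congr rfl fun ω _ => ?_
  rcases (hp.1 ω).eq_or_lt with h | h
  · simp [← h]
  · rw [Real.logb_div (sum_fst_pos hp h).ne' (mul_pos (margS1_pos hp h) (margT2_pos hp h)).ne',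
      Real.logb_mul (margS1_pos hp h).ne' (margT2_pos hp h).ne']
    ring

lemma rvMI_add_rvMI_add_rvCMI_eq (hp : IsPmf p) :
    rvMI p (fun ω => ω.2.1) (fun ω => ω.1) + rvMI p (fun ω => ω.2.2) (fun ω => ω.1)
      + rvCMI p (fun ω => ω.2.1) (fun ω => ω.2.2) (fun ω => ω.1)
      = ∑ ω, p ω * Real.logb 2
        (p ω / (margS1 p ω.1 * margT1 p ω.2.1 * margT2 p ω.2.2)) := by
  simp only [rvMI, rvCMI, rvEnt_eq, rvDist_fst, rvDist_snd_fst, rvDist_snd_snd,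
    rvDist_snd_fst_fst, rvDist_snd_snd_fst, rvDist_perm,
    ← Finset.sum_neg_distrib, ← Finset.sum_add_distrib, ← Finset.sum_sub_distrib]
  refine Finset.sum_congr rfl fun ω _ => ?_
  rcases (hp.1 ω).eq_or_lt with h | h
  · simp [← h]
  · have hs := margS1_pos hp h
    have hu := margT1_pos hp h
    have hv := margT2_pos hp h
    rw [Real.logb_div h.ne' (mul_pos (mul_pos hs hu) hv).ne',
      Real.logb_mul (mul_pos hs hu).ne' hv.ne', Real.logb_mul hs.ne' hu.ne']
    ring

end Information

section CoverBounds

variable {𝒮₁ T₁ T₂ : Type} [Fintype 𝒮₁] [Fintype T₁] [Fintype T₂]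
  {p : 𝒮₁ × T₁ × T₂ → ℝ} {n K L : ℕ}

lemma codebook_weight_nonneg (hp : IsPmf p) (s : Fin n → 𝒮₁) (c : Fin K → Fin n → T₁)
    (d : Fin L → Fin n → T₂) :
    0 ≤ (∏ j, margS1 p (s j)) * (∏ k, ∏ j, margT1 p (c k j)) * ∏ l, ∏ j, margT2 p (d l j) :=
  mul_nonneg (mul_nonneg
    (Finset.prod_nonneg fun _ _ => Finset.sum_nonneg fun _ _ => hp.1 _)
    (Finset.prod_nonneg fun _ _ => Finset.prod_nonneg fun _ _ => (isPmf_margT1 hp).1 _))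
    (Finset.prod_nonneg fun _ _ => Finset.prod_nonneg fun _ _ => (isPmf_margT2 hp).1 _)

lemma isPmf_pi {A : Type} [Fintype A] {a : A → ℝ} (ha : IsPmf a) :
    IsPmf fun x : Fin n → A => ∏ j, a (x j) :=
  ⟨fun _ => Finset.prod_nonneg fun _ _ => ha.1 _, sum_pi_prod_eq_one ha.2⟩

lemma one_sub_coverProb_eq (hp : IsPmf p) (ε : ℝ) :
    1 - coverProb p ε n K L = ∑ s : Fin n → 𝒮₁, ∑ c : Fin K → Fin n → T₁,
      ∑ d : Fin L → Fin n → T₂,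
        if ∃ k l, StrongTypical p ε (fun j => (s j, c k j, d l j)) then 0 else
          (∏ j, margS1 p (s j)) * (∏ k, ∏ j, margT1 p (c k j)) * ∏ l, ∏ j, margT2 p (d l j) := by
  have h1 : ∑ s : Fin n → 𝒮₁, ∑ c : Fin K → Fin n → T₁, ∑ d : Fin L → Fin n → T₂,
      (∏ j, margS1 p (s j)) * (∏ k, ∏ j, margT1 p (c k j)) * ∏ l, ∏ j, margT2 p (d l j) = 1 := by
    simp_rw [← Finset.mul_sum]
    rw [sum_pi_prod_eq_one (isPmf_pi (isPmf_margT2 hp)).2]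
    simp_rw [mul_one, ← Finset.mul_sum]
    rw [sum_pi_prod_eq_one (isPmf_pi (isPmf_margT1 hp)).2]
    simp_rw [mul_one]
    exact sum_pi_prod_eq_one (sum_margS1 hp)
  rw [sub_eq_iff_eq_add, ← h1, coverProb]
  simp_rw [← Finset.sum_add_distrib]
  refine Finset.sum_congr rfl fun s _ => Finset.sum_congr rfl fun c _ =>
    Finset.sum_congr rfl fun d _ => ?_
  split_ifs <;> simp

lemma coverProb_le_one (hp : IsPmf p) {ε : ℝ} : coverProb p ε n K L ≤ 1 := by
  rw [← sub_nonneg, one_sub_coverProb_eq hp]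
  refine Finset.sum_nonneg fun s _ => Finset.sum_nonneg fun c _ => Finset.sum_nonneg fun d _ => ?_
  split_ifs
  exacts [le_rfl, codebook_weight_nonneg hp s c d]

lemma coverProb_mono (hp : IsPmf p) {ε ε' : ℝ} (h : ε' ≤ ε) :
    coverProb p ε' n K L ≤ coverProb p ε n K L := by
  refine Finset.sum_le_sum fun s _ => Finset.sum_le_sum fun c _ => Finset.sum_le_sum fun d _ => ?_
  have hw := codebook_weight_nonneg hp s c d
  split_ifs with h₁ h₂ h₂
  · exact le_rfl
  · obtain ⟨k, l, hkl⟩ := h₁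
    exact absurd ⟨k, l, hkl.mono hp h⟩ h₂
  · exact hw
  · exact le_rfl

lemma sum_fin_triple (F : (Fin n → 𝒮₁ × T₁ × T₂) → ℝ) :
    ∑ x, F x = ∑ s : Fin n → 𝒮₁, ∑ u : Fin n → T₁, ∑ v : Fin n → T₂,
      F fun j => (s j, u j, v j) := by
  rw [← (Equiv.arrowProdEquivProdArrow (Fin n) (fun _ => 𝒮₁) fun _ => T₁ × T₂).symm.sum_comp,
    Fintype.sum_prod_type]
  refine Finset.sum_congr rfl fun s _ => ?_
  rw [← (Equiv.arrowProdEquivProdArrow (Fin n) (fun _ => T₁) fun _ => T₂).symm.sum_comp,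
    Fintype.sum_prod_type]
  rfl

/-- Exponential bound for the probability that no pair of codewords is jointly typical with the
state sequence. -/
lemma exists_one_sub_coverProb_le (hp : IsPmf p) :
    ∃ C : ℝ, 0 ≤ C ∧ ∀ ε : ℝ, 0 < ε → ∀ n K L : ℕ, 0 < n → 0 < K → 0 < L →
      1 - coverProb p ε n K L
        ≤ (2 : ℝ) ^ ((n : ℝ) * (rvMI p (fun ω => ω.2.1) (fun ω => ω.1)
              + rvMI p (fun ω => ω.2.2) (fun ω => ω.1)
              + rvCMI p (fun ω => ω.2.1) (fun ω => ω.2.2) (fun ω => ω.1) + ε * C)) / (K * L)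
          + (2 : ℝ) ^ ((n : ℝ) * (rvMI p (fun ω => ω.2.1) (fun ω => ω.1) + ε * C)) / K
          + (2 : ℝ) ^ ((n : ℝ) * (rvMI p (fun ω => ω.2.2) (fun ω => ω.1) + ε * C)) / L
          + (∑ ω, 1 / (ε * p ω) ^ 2) / n := by
  have hprod : ∀ {f g : 𝒮₁ × T₁ × T₂ → ℝ}, (∀ ω, 0 < p ω → 0 < f ω) →
      (∀ ω, 0 < p ω → 0 < g ω) → ∃ C : ℝ, 0 ≤ C ∧ ∀ C', C ≤ C' → ∀ ε : ℝ, 0 < ε →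
        ∀ (n : ℕ) (x : Fin n → 𝒮₁ × T₁ × T₂), StrongTypical p ε x → ∏ j, f (x j) ≤
          (2 : ℝ) ^ ((n : ℝ) * (∑ ω, p ω * Real.logb 2 (f ω / g ω) + ε * C'))
            * ∏ j, g (x j) := fun {f g} hf hg => by
    refine ⟨∑ ω, p ω * |Real.logb 2 (f ω / g ω)|,
      Finset.sum_nonneg fun ω _ => mul_nonneg (hp.1 ω) (abs_nonneg _),
      fun C' hC' ε hε n x hx => (hx.prod_le hp hf hg).trans ?_⟩
    refine mul_le_mul_of_nonneg_right ?_
      (Finset.prod_nonneg fun j _ => (hg _ (hx.pos hp j)).le)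
    refine Real.rpow_le_rpow_of_exponent_le one_le_two ?_
    gcongr
  obtain ⟨C₁, hC₁, h₁⟩ := hprod (f := fun ω => ∑ v, p (ω.1, ω.2.1, v))
    (g := fun ω => margS1 p ω.1 * margT1 p ω.2.1) (fun ω => sum_snd_pos hp)
    (fun ω h => mul_pos (margS1_pos hp h) (margT1_pos hp h))
  obtain ⟨C₂, hC₂, h₂⟩ := hprod (f := fun ω => ∑ u, p (ω.1, u, ω.2.2))
    (g := fun ω => margS1 p ω.1 * margT2 p ω.2.2) (fun ω => sum_fst_pos hp)
    (fun ω h => mul_pos (margS1_pos hp h) (margT2_pos hp h))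
  obtain ⟨C₃, hC₃, h₃⟩ := hprod (f := p)
    (g := fun ω => margS1 p ω.1 * margT1 p ω.2.1 * margT2 p ω.2.2) (fun ω => id)
    (fun ω h => mul_pos (mul_pos (margS1_pos hp h) (margT1_pos hp h)) (margT2_pos hp h))
  refine ⟨C₁ + C₂ + C₃, by positivity, fun ε hε n K L hn hK hL => ?_⟩
  have h₁' := h₁ (C₁ + C₂ + C₃) (by linarith) ε hε n
  have h₂' := h₂ (C₁ + C₂ + C₃) (by linarith) ε hε n
  have h₃' := h₃ (C₁ + C₂ + C₃) (by linarith) ε hε n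
  rw [← rvMI_T1_eq hp] at h₁'
  rw [← rvMI_T2_eq hp] at h₂'
  rw [← rvMI_add_rvMI_add_rvCMI_eq hp] at h₃'
  simp only [Finset.prod_mul_distrib] at h₁' h₂' h₃'
  have hmarg₁ : ∀ (s : Fin n → 𝒮₁) (u : Fin n → T₁),
      ∑ v : Fin n → T₂, ∏ j, p (s j, u j, v j) = ∏ j, ∑ v, p (s j, u j, v) :=
    fun s u => sum_pi_prod_s10 fun j v => p (s j, u j, v)
  have hmarg₂ : ∀ (s : Fin n → 𝒮₁) (v : Fin n → T₂),
      ∑ u : Fin n → T₁, ∏ j, p (s j, u j, v j) = ∏ j, ∑ u, p (s j, u, v j) :=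
    fun s v => sum_pi_prod_s10 fun j u => p (s j, u, v j)
  have hmarg : ∀ s : Fin n → 𝒮₁,
      ∑ u : Fin n → T₁, ∑ v : Fin n → T₂, ∏ j, p (s j, u j, v j) = ∏ j, margS1 p (s j) :=
    fun s => by
      simp_rw [hmarg₁, margS1, Fintype.sum_prod_type]
      exact sum_pi_prod_s10 fun j u => ∑ v, p (s j, u, v)
  have hpos : ∀ (s : Fin n → 𝒮₁) (u : Fin n → T₁) (v : Fin n → T₂),
      StrongTypical p ε (fun j => (s j, u j, v j)) →
      0 < ∏ j, margT1 p (u j) ∧ 0 < ∏ j, margT2 p (v j) := fun s u v h =>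
    ⟨Finset.prod_pos fun j _ => margT1_pos hp (h.pos hp j),
      Finset.prod_pos fun j _ => margT2_pos hp (h.pos hp j)⟩
  have hcov := one_shot_covering (isPmf_pi (n := n) (isPmf_margT1 hp))
    (isPmf_pi (n := n) (isPmf_margT2 hp))
    (P := fun (s : Fin n → 𝒮₁) u v => ∏ j, p (s j, u j, v j))
    (fun s u v => Finset.prod_nonneg fun j _ => hp.1 _) hmarg
    (sum_pi_prod_eq_one (sum_margS1 hp))
    (A := fun s u v => StrongTypical p ε fun j => (s j, u j, v j))
    hpos (Real.rpow_nonneg two_pos.le _) (Real.rpow_nonneg two_pos.le _)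
    (Real.rpow_nonneg two_pos.le _)
    (fun s u v h => h₃' _ h)
    (fun s u v h => (hmarg₁ s u).trans_le (h₁' _ h))
    (fun s u v h => (hmarg₂ s v).trans_le (h₂' _ h)) hK hL
  have htyp := one_sub_le_sum_typical hp hn hε
  rw [sum_fin_triple] at htyp
  rw [one_sub_coverProb_eq hp]
  linarith

end CoverBounds

/-- **Mutual covering step of the encoding.**  Let `(S₁,T₁,T₂)` have joint pmf `p`.
Generate `⌈2^{nR₁'}⌉` codewords `T₁ⁿ(k)` i.i.d. `∼ p(t₁)` and `⌈2^{nR₂'}⌉` codewords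
`T₂ⁿ(l)` i.i.d. `∼ p(t₂)`, independently of each other and of the i.i.d. sequence
`S₁ⁿ ∼ p(s₁)`.  There is `δ(ε) > 0` with `δ(ε) → 0` as `ε → 0` such that if
`R₁' > I(T₁;S₁) + δ(ε)`, `R₂' > I(T₂;S₁) + δ(ε)` and
`R₁' + R₂' > I(T₁;S₁) + I(T₂;S₁) + I(T₁;T₂|S₁) + δ(ε)`, then the probability that
some pair `(k,l)` is jointly strongly `ε`-typical with `S₁ⁿ` tends to `1`. -/
theorem mutual_covering
    {𝒮₁ T₁ T₂ : Type} [Fintype 𝒮₁] [Fintype T₁] [Fintype T₂]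
    (p : 𝒮₁ × T₁ × T₂ → ℝ) (hp : IsPmf p) :
    ∃ δ : ℝ → ℝ, (∀ ε : ℝ, 0 < ε → 0 < δ ε) ∧
      Filter.Tendsto δ (nhdsWithin 0 (Set.Ioi 0)) (nhds 0) ∧
      ∀ ε : ℝ, 0 < ε → ∀ R1 R2 : ℝ,
        R1 > rvMI p (fun ω => ω.2.1) (fun ω => ω.1) + δ ε →
        R2 > rvMI p (fun ω => ω.2.2) (fun ω => ω.1) + δ ε →
        R1 + R2 > rvMI p (fun ω => ω.2.1) (fun ω => ω.1)
            + rvMI p (fun ω => ω.2.2) (fun ω => ω.1)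
            + rvCMI p (fun ω => ω.2.1) (fun ω => ω.2.2) (fun ω => ω.1) + δ ε →
        Filter.Tendsto
          (fun n : ℕ =>
            coverProb p ε n ⌈(2:ℝ) ^ ((n:ℝ) * R1)⌉₊ ⌈(2:ℝ) ^ ((n:ℝ) * R2)⌉₊)
          Filter.atTop (nhds 1) := by
  refine ⟨fun ε => ε, fun ε hε => hε, tendsto_nhdsWithin_of_tendsto_nhds Filter.tendsto_id, ?_⟩
  intro ε hε R1 R2 h1 h2 h12
  obtain ⟨C, hC, hbound⟩ := exists_one_sub_coverProb_le hp
  set ε' : ℝ := min ε (ε / 2 / (C + 1)) with hε'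
  have hε'0 : 0 < ε' := lt_min hε (by positivity)
  have hε'C : ε' * C ≤ ε / 2 := by
    have h : ε' ≤ ε / 2 / (C + 1) := min_le_right _ _
    rw [le_div_iff₀ (by positivity)] at h
    nlinarith
  have hpow : ∀ (n : ℕ) (r : ℝ), r ≤ -(ε / 2) →
      (2 : ℝ) ^ ((n : ℝ) * r) ≤ ((2 : ℝ) ^ (-(ε / 2))) ^ n := fun n r hr => by
    rw [mul_comm, Real.rpow_mul_natCast two_pos.le]
    exact pow_le_pow_left₀ (by positivity) (Real.rpow_le_rpow_of_exponent_le one_le_two hr) n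
  have hlim : Filter.Tendsto (fun n : ℕ => 1 - (3 * ((2 : ℝ) ^ (-(ε / 2))) ^ n
      + (∑ ω, 1 / (ε' * p ω) ^ 2) / n)) Filter.atTop (nhds 1) := by
    have hgeo : Filter.Tendsto (fun n : ℕ => ((2 : ℝ) ^ (-(ε / 2))) ^ n) Filter.atTop (nhds 0) :=
      tendsto_pow_atTop_nhds_zero_of_lt_one (by positivity)
        (Real.rpow_lt_one_of_one_lt_of_neg one_lt_two (by linarith))
    have h := ((hgeo.const_mul 3).add
      (tendsto_const_div_atTop_nhds_zero_nat (∑ ω, 1 / (ε' * p ω) ^ 2))).const_sub 1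
    rw [mul_zero, add_zero, sub_zero] at h
    exact h
  refine tendsto_of_tendsto_of_tendsto_of_le_of_le' hlim tendsto_const_nhds ?_
    (Filter.Eventually.of_forall fun n => coverProb_le_one hp)
  filter_upwards [Filter.eventually_gt_atTop 0] with n hn
  set K := ⌈(2 : ℝ) ^ ((n : ℝ) * R1)⌉₊ with hK
  set L := ⌈(2 : ℝ) ^ ((n : ℝ) * R2)⌉₊ with hL
  have hR1 : 0 < (2 : ℝ) ^ ((n : ℝ) * R1) := by positivity
  have hR2 : 0 < (2 : ℝ) ^ ((n : ℝ) * R2) := by positivity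
  have hKR : (2 : ℝ) ^ ((n : ℝ) * R1) ≤ K := Nat.le_ceil _
  have hLR : (2 : ℝ) ^ ((n : ℝ) * R2) ≤ L := Nat.le_ceil _
  have hdiv : ∀ (I R x : ℝ), (2 : ℝ) ^ ((n : ℝ) * R) ≤ x → I + ε < R →
      (2 : ℝ) ^ ((n : ℝ) * (I + ε' * C)) / x ≤ ((2 : ℝ) ^ (-(ε / 2))) ^ n :=
    fun I R x hx hIR => by
      refine (div_le_div_of_nonneg_left (by positivity) (by positivity) hx).trans ?_
      rw [← Real.rpow_sub two_pos, ← mul_sub]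
      exact hpow n _ (by linarith)
  have hKL : (2 : ℝ) ^ ((n : ℝ) * (R1 + R2)) ≤ K * L := by
    rw [mul_add, Real.rpow_add two_pos]
    exact mul_le_mul hKR hLR hR2.le (Nat.cast_nonneg _)
  have hb := hbound ε' hε'0 n K L hn (Nat.ceil_pos.2 hR1) (Nat.ceil_pos.2 hR2)
  have hmono := coverProb_mono hp (min_le_left ε (ε / 2 / (C + 1))) (n := n) (K := K) (L := L)
  have d1 := hdiv _ R1 K hKR h1
  have d2 := hdiv _ R2 L hLR h2
  have d12 := hdiv _ (R1 + R2) (K * L) hKL h12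
  rw [← hε'] at hmono
  linarith

end
end
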